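/- Let T > 0, M > 0, let l ≥ 2 be an integer, let r ≥ 1 be an integer and γ > 0 a real number, let s, ζ be as in the definition of Q*_{r,γ}, and set v = s/(s−γ). Regard X = Q*_{r,γ}([0,T]^l, M) as a subset of the Banach space C([0,T]^l) with the supremum norm, and define ε_n = n^{−(s−γ)/(l−1)} if v > l/(l−1), ε_n = n^{−s/l}(ln n)^{s/l} if v = l/(l−1), and ε_n = n^{−s/l} if v < l/(l−1). Then there exist constants c₁, c₂ > 0 and n₀ ∈ ℕ such that for all n ≥ n₀: c₁ ε_n ≤ d_n(X, C([0,T]^l)) ≤ c₂ ε_n and c₁ ε_n ≤ δ_n(X) ≤ c₂ ε_n. -/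

import Mathlib

open Set Metric

/-- The Kolmogorov `n`-width of a subset `X` of a real normed space `B`. -/
noncomputable def kolmogorovWidth {B : Type*} [NormedAddCommGroup B] [NormedSpace ℝ B]
    (n : ℕ) (X : Set B) : ℝ :=
  sInf { d : ℝ | ∃ L : Submodule ℝ B, FiniteDimensional ℝ L ∧
    Module.finrank ℝ L ≤ n ∧ d = ⨆ x : X, ⨅ u : L, ‖(x : B) - (u : B)‖ }

/-- The Babenko `n`-width of a subset `X` of a real normed space. -/
noncomputable def babenkoWidth {B : Type*} [NormedAddCommGroup B]
    (n : ℕ) (X : Set B) : ℝ :=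
  sInf { d : ℝ | ∃ p : X → (Fin n → ℝ), Continuous p ∧
    d = ⨆ x : X, Metric.diam (Subtype.val '' (p ⁻¹' {p x})) }

/-- The cube `Ω = [0,T]^l` as a subset of `ℝ^l`. -/
def cube (l : ℕ) (T : ℝ) : Set (Fin l → ℝ) := Set.pi Set.univ fun _ => Set.Icc 0 T

/-- `ρ(t, Γ₀) = min_i |t_i|`. -/
noncomputable def rho {l : ℕ} (t : Fin l → ℝ) : ℝ := ⨅ i, |t i|

/-- The class `Q*_{r,γ}([0,T]^l, M)`: mixed partial derivatives (realized as values of the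
iterated Fréchet derivative on sequences of coordinate directions) of total order `≤ r` are
bounded by `M` on the cube, while those of total order `k` with `r < k ≤ s` are bounded by
`M ρ(t,Γ₀)^{-(k-r-ζ)}` away from `Γ₀`. -/
def MemQStarMulti (l : ℕ) (T M : ℝ) (r s : ℕ) (ζ : ℝ) (f : (Fin l → ℝ) → ℝ) : Prop :=
  ContDiffOn ℝ r f (cube l T) ∧
  ContDiffOn ℝ s f {t ∈ cube l T | 0 < rho t} ∧
  (∀ k : ℕ, k ≤ r → ∀ m : Fin k → Fin l, ∀ t ∈ cube l T,
      |iteratedFDerivWithin ℝ k f (cube l T) t (fun j => Pi.single (m j) 1)| ≤ M) ∧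
  (∀ k : ℕ, r < k → k ≤ s → ∀ m : Fin k → Fin l, ∀ t ∈ {t ∈ cube l T | 0 < rho t},
      |iteratedFDerivWithin ℝ k f {t ∈ cube l T | 0 < rho t} t
          (fun j => Pi.single (m j) 1)| ≤ M * rho t ^ (-((k : ℝ) - r - ζ)))

namespace WQ

/-- Change of variables for a small compactly supported perturbation of the identity. -/
theorem small_pert {N : ℕ} (w : (Fin N → ℝ) → (Fin N → ℝ)) (hw : ContDiff ℝ 1 w)
    (hsupp : ∀ x, 3 < ‖x‖ → w x = 0) (φ : (Fin N → ℝ) → ℝ) :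
    ∀ᶠ t : ℝ in nhds 0, ∫ x in closedBall (0 : Fin N → ℝ) 4,
      (ContinuousLinearMap.id ℝ (Fin N → ℝ) + t • fderiv ℝ w x).det * φ (x + t • w x)
      = ∫ x in closedBall (0 : Fin N → ℝ) 4, φ x := by
  have hcs : HasCompactSupport w := by
    refine HasCompactSupport.intro (isCompact_closedBall (0 : Fin N → ℝ) 3) ?_
    intro x hx
    apply hsupp
    simpa using hx
  obtain ⟨K, hK⟩ := hw.lipschitzWith_of_hasCompactSupport hcs one_ne_zero
  have hcontd : Continuous fun z : ℝ × (Fin N → ℝ) =>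
      (ContinuousLinearMap.id ℝ (Fin N → ℝ) + z.1 • fderiv ℝ w z.2).det := by
    apply ContinuousLinearMap.continuous_det.comp
    have : Continuous (fderiv ℝ w) := hw.continuous_fderiv one_ne_zero
    fun_prop
  have hpos : ∀ᶠ t : ℝ in nhds 0, ∀ x ∈ closedBall (0 : Fin N → ℝ) 4,
      0 < (ContinuousLinearMap.id ℝ (Fin N → ℝ) + t • fderiv ℝ w x).det := by
    refine (isCompact_closedBall (0 : Fin N → ℝ) 4).eventually_forall_of_forall_eventually
      (P := fun t x => 0 < (ContinuousLinearMap.id ℝ (Fin N → ℝ) + t • fderiv ℝ w x).det) ?_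
    intro y _
    refine (hcontd.tendsto (0, y)).eventually (lt_mem_nhds ?_)
    simp [ContinuousLinearMap.det]
  have hsm : ∀ᶠ t : ℝ in nhds 0, |t| * K < 1 := by
    have : Filter.Tendsto (fun t : ℝ => |t| * (K : ℝ)) (nhds 0) (nhds (|0| * K)) :=
      (continuous_abs.mul continuous_const).tendsto 0
    exact this.eventually (gt_mem_nhds (by simp))
  filter_upwards [hpos, hsm] with t ht hts
  set h : (Fin N → ℝ) → (Fin N → ℝ) := fun x => x + t • w x with hh
  have hlip : ∀ x y, ‖w x - w y‖ ≤ K * ‖x - y‖ := fun x y => by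
    simpa [dist_eq_norm] using hK.dist_le_mul x y
  have hinj : Function.Injective h := by
    intro x y hxy
    have h1 : x - y = -(t • (w x - w y)) := by
      simp only [hh] at hxy
      have := sub_eq_zero.2 hxy
      rw [smul_sub, ← sub_eq_zero, ← this]; abel
    have h2 : ‖x - y‖ ≤ |t| * K * ‖x - y‖ := by
      conv_lhs => rw [h1, norm_neg, norm_smul, Real.norm_eq_abs]
      rw [mul_assoc]
      exact mul_le_mul_of_nonneg_left (hlip x y) (abs_nonneg t)
    have h3 : ‖x - y‖ ≤ 0 := by
      by_contra hc
      push Not at hc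
      nlinarith
    exact sub_eq_zero.1 (norm_le_zero_iff.1 h3)
  have happ : ApproximatesLinearOn h
      ((ContinuousLinearEquiv.refl ℝ (Fin N → ℝ) : (Fin N → ℝ) ≃L[ℝ] (Fin N → ℝ)) :
        (Fin N → ℝ) →L[ℝ] (Fin N → ℝ)) univ (‖t‖₊ * K) := by
    intro x _ y _
    have : h x - h y - (ContinuousLinearEquiv.refl ℝ (Fin N → ℝ) :
        (Fin N → ℝ) →L[ℝ] (Fin N → ℝ)) (x - y) = t • (w x - w y) := by
      simp only [hh, smul_sub, ContinuousLinearEquiv.coe_refl, ContinuousLinearMap.coe_id', id]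
      abel
    rw [this, norm_smul]
    push_cast
    rw [mul_assoc]
    exact mul_le_mul_of_nonneg_left (hlip x y) (norm_nonneg t)
  have hsurj : Function.Surjective h := by
    rcases Nat.eq_zero_or_pos N with h0 | h0
    · subst h0
      intro y; exact ⟨y, Subsingleton.elim _ _⟩
    · have : Nonempty (Fin N) := ⟨⟨0, h0⟩⟩
      refine happ.surjective (Or.inr ?_)
      have : ‖(((ContinuousLinearEquiv.refl ℝ (Fin N → ℝ)).symm : (Fin N → ℝ) ≃L[ℝ] (Fin N → ℝ)) :
        (Fin N → ℝ) →L[ℝ] (Fin N → ℝ))‖₊ = 1 := by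
        have := ContinuousLinearMap.nnnorm_id (𝕜 := ℝ) (E := Fin N → ℝ)
        simpa using this
      rw [this]
      rw [← NNReal.coe_lt_coe]
      simpa using hts
  have hout : ∀ x, 3 < ‖x‖ → h x = x := fun x hx => by simp [hh, hsupp x hx]
  have himg : h '' closedBall 0 4 = closedBall 0 4 := by
    ext y
    constructor
    · rintro ⟨x, hx, rfl⟩
      by_contra hc
      simp only [mem_closedBall, dist_zero_right, not_le] at hc hx
      have := hinj (hout (h x) (by linarith))
      rw [this] at hc
      linarith
    · intro hy
      obtain ⟨x, rfl⟩ := hsurj y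
      refine ⟨x, ?_, rfl⟩
      by_contra hc
      simp only [mem_closedBall, dist_zero_right, not_le] at hc hy
      rw [hout x (by linarith)] at hy
      linarith
  have hder : ∀ x ∈ closedBall (0 : Fin N → ℝ) 4, HasFDerivWithinAt h
      (ContinuousLinearMap.id ℝ (Fin N → ℝ) + t • fderiv ℝ w x) (closedBall 0 4) x := by
    intro x _
    apply HasFDerivAt.hasFDerivWithinAt
    exact (hasFDerivAt_id x).add (((hw.differentiable one_ne_zero) x).hasFDerivAt.const_smul t)
  have := MeasureTheory.integral_image_eq_integral_abs_det_fderiv_smul MeasureTheory.volume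
    measurableSet_closedBall hder hinj.injOn φ
  rw [himg] at this
  rw [this]
  apply MeasureTheory.setIntegral_congr_fun measurableSet_closedBall
  intro x hx
  simp only [smul_eq_mul]
  rw [abs_of_pos (ht x hx)]

/-- The ring homomorphism evaluating a polynomial with coefficients in continuous functions. -/
noncomputable def evx {N : ℕ} (t : ℝ) (x : Fin N → ℝ) :
    Polynomial (C(Fin N → ℝ, ℝ)) →+* ℝ :=
  Polynomial.eval₂RingHom ((ContinuousMap.evalAlgHom ℝ ℝ x : C(Fin N → ℝ, ℝ) →ₐ[ℝ] ℝ) :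
    C(Fin N → ℝ, ℝ) →+* ℝ) t

theorem evx_C {N : ℕ} (t : ℝ) (x : Fin N → ℝ) (g : C(Fin N → ℝ, ℝ)) :
    evx t x (Polynomial.C g) = g x := by
  simp [evx]

theorem evx_X {N : ℕ} (t : ℝ) (x : Fin N → ℝ) :
    evx t x Polynomial.X = t := by
  simp [evx]

theorem integral_evx {N : ℕ} (p : Polynomial (C(Fin N → ℝ, ℝ))) :
    ∃ P : Polynomial ℝ, ∀ t, ∫ x in closedBall (0 : Fin N → ℝ) 4, evx t x p = P.eval t := by
  refine ⟨∑ i ∈ Finset.range (p.natDegree + 1), Polynomial.C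
    (∫ x in closedBall (0 : Fin N → ℝ) 4, p.coeff i x) * Polynomial.X ^ i, fun t => ?_⟩
  have : ∀ x, evx t x p = ∑ i ∈ Finset.range (p.natDegree + 1), p.coeff i x * t ^ i := by
    intro x
    simp [evx, Polynomial.eval₂_eq_sum_range]
  simp_rw [this]
  rw [MeasureTheory.integral_finsetSum]
  · rw [Polynomial.eval_finsetSum]
    refine Finset.sum_congr rfl fun i _ => ?_
    rw [MeasureTheory.integral_mul_const]
    simp
  · intro i _
    apply MeasureTheory.Integrable.mul_const
    exact (p.coeff i).continuous.continuousOn.integrableOn_compact (isCompact_closedBall _ _)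

/-- The integral identity for arbitrary perturbations and test powers. -/
theorem big_pert {N : ℕ} (w : (Fin N → ℝ) → (Fin N → ℝ)) (hw : ContDiff ℝ 1 w)
    (hsupp : ∀ x, 3 < ‖x‖ → w x = 0) (κ : ℝ) (k : ℕ) :
    ∫ x in closedBall (0 : Fin N → ℝ) 4,
      (ContinuousLinearMap.id ℝ (Fin N → ℝ) + fderiv ℝ w x).det *
        (1 - κ * ∑ i, ((x + w x) i) ^ 2) ^ k
      = ∫ x in closedBall (0 : Fin N → ℝ) 4, (1 - κ * ∑ i, (x i) ^ 2) ^ k := by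
  classical
  have hcf : Continuous (fderiv ℝ w) := hw.continuous_fderiv one_ne_zero
  have hwc : Continuous w := hw.continuous
  let e : Fin N → C(Fin N → ℝ, ℝ) := fun i => ⟨fun x => x i, by fun_prop⟩
  let we : Fin N → C(Fin N → ℝ, ℝ) := fun i => ⟨fun x => w x i, by fun_prop⟩
  let m : Fin N → Fin N → C(Fin N → ℝ, ℝ) := fun i j =>
    ⟨fun x => fderiv ℝ w x (Pi.single j 1) i, by fun_prop⟩
  let κe : C(Fin N → ℝ, ℝ) := ⟨fun _ => κ, continuous_const⟩
  let A : Matrix (Fin N) (Fin N) (Polynomial (C(Fin N → ℝ, ℝ))) :=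
    Matrix.of fun i j => (if i = j then 1 else 0) + Polynomial.X * Polynomial.C (m i j)
  let p : Polynomial (C(Fin N → ℝ, ℝ)) := A.det *
    (1 - Polynomial.C κe * ∑ i, (Polynomial.C (e i) + Polynomial.X * Polynomial.C (we i)) ^ 2) ^ k
  obtain ⟨P, hP⟩ := integral_evx p
  have hev : ∀ t x, evx t x p =
      (ContinuousLinearMap.id ℝ (Fin N → ℝ) + t • fderiv ℝ w x).det *
        (1 - κ * ∑ i, ((x + t • w x) i) ^ 2) ^ k := by
    intro t x
    simp only [p, map_mul, map_pow, map_sub, map_one, map_sum, map_add, evx_C, evx_X]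
    congr 1
    rw [RingHom.map_det, ContinuousLinearMap.det, ← LinearMap.det_toMatrix']
    congr 1
    ext i j
    simp only [A, RingHom.mapMatrix_apply, Matrix.map_apply, Matrix.of_apply, map_add, map_mul,
      evx_C, evx_X, LinearMap.toMatrix'_apply]
    simp only [ContinuousLinearMap.coe_coe, add_apply,
      smul_apply, Pi.add_apply, Pi.smul_apply, smul_eq_mul,
      ContinuousLinearMap.coe_id', id, m, ContinuousMap.coe_mk]
    congr 1
    · by_cases hij : i = j
      · subst hij; simp
      · simp [hij]
  have hsm := small_pert w hw hsupp (fun y => (1 - κ * ∑ i, (y i) ^ 2) ^ k)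
  set c := ∫ x in closedBall (0 : Fin N → ℝ) 4, (1 - κ * ∑ i, (x i) ^ 2) ^ k with hc
  have hPc : P = Polynomial.C c := by
    apply Polynomial.eq_of_infinite_eval_eq
    have hinf : (nhds (0 : ℝ)).NeBot := inferInstance
    have hmem : {t : ℝ | P.eval t = (Polynomial.C c).eval t} ∈ nhds (0 : ℝ) := by
      filter_upwards [hsm] with t ht
      simp only [Polynomial.eval_C, mem_ofPred_eq]
      rw [← hP t, ← ht]
      simp_rw [hev]
    exact infinite_of_mem_nhds 0 hmem
  have h1 := hP 1
  rw [hPc, Polynomial.eval_C] at h1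
  rw [← h1]
  simp_rw [hev]
  simp

end WQ

namespace WQ

theorem no_degenerate {N : ℕ} (hN : 0 < N) (h : (Fin N → ℝ) → (Fin N → ℝ)) (hh : ContDiff ℝ 1 h)
    (hid : ∀ x, ‖x‖ ≤ 3 → ‖h x - x‖ ≤ 3 / 4) (hdet : ∀ x, (fderiv ℝ h x).det = 0) : False := by
  have hne : Nonempty (Fin N) := ⟨⟨0, hN⟩⟩
  have hNr : (1 : ℝ) ≤ N := by exact_mod_cast hN
  let χ : ContDiffBump (0 : Fin N → ℝ) := ⟨2, 3, by norm_num, by norm_num⟩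
  let w : (Fin N → ℝ) → (Fin N → ℝ) := fun x => χ x • (h x - x)
  have hw : ContDiff ℝ 1 w := χ.contDiff.smul (hh.sub contDiff_id)
  have hsupp : ∀ x, 3 ≤ ‖x‖ → w x = 0 := by
    intro x hx
    have : χ x = 0 := χ.zero_of_le_dist (by simpa using hx)
    simp [w, this]
  have hwn : ∀ x, ‖w x‖ ≤ 3 / 4 := by
    intro x
    rcases le_total 3 ‖x‖ with h3 | h3
    · rw [hsupp x h3]; norm_num
    · simp only [w, norm_smul, Real.norm_eq_abs, abs_of_nonneg χ.nonneg]
      calc χ x * ‖h x - x‖ ≤ 1 * ‖h x - x‖ :=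
            mul_le_mul_of_nonneg_right χ.le_one (norm_nonneg _)
        _ ≤ 3 / 4 := by rw [one_mul]; exact hid x h3
  set D : (Fin N → ℝ) → ℝ := fun x => (ContinuousLinearMap.id ℝ (Fin N → ℝ) + fderiv ℝ w x).det
    with hD
  have hDc : Continuous D := by
    apply ContinuousLinearMap.continuous_det.comp
    have : Continuous (fderiv ℝ w) := hw.continuous_fderiv one_ne_zero
    fun_prop
  have hD0 : ∀ x, ‖x‖ < 2 → D x = 0 := by
    intro x hx
    have heq : (fun y => y + w y) =ᶠ[nhds x] h := by
      have : ball (0 : Fin N → ℝ) 2 ∈ nhds x := isOpen_ball.mem_nhds (by simpa using hx)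
      filter_upwards [this] with y hy
      have : χ y = 1 := χ.one_of_mem_closedBall (ball_subset_closedBall hy)
      simp [w, this]
    have h1 : fderiv ℝ (fun y => y + w y) x = ContinuousLinearMap.id ℝ (Fin N → ℝ) + fderiv ℝ w x :=
      ((hasFDerivAt_id x).add ((hw.differentiable one_ne_zero) x).hasFDerivAt).fderiv
    simp only [hD]
    rw [← h1, heq.fderiv_eq, hdet]
  obtain ⟨C, hC⟩ := (isCompact_closedBall (0 : Fin N → ℝ) 4).exists_bound_of_continuousOn
    hDc.continuousOn
  set κ : ℝ := 1 / (16 * N) with hκ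
  have hκ0 : 0 < κ := by positivity
  have hκN : κ * N = 1 / 16 := by rw [hκ]; field_simp
  have hκ1 : κ ≤ 1 / 16 := by nlinarith
  set q : ℝ := 1 - κ with hq
  set q' : ℝ := 1 - κ / 4 with hq'
  have hsum_le : ∀ (y : Fin N → ℝ) (b : ℝ), ‖y‖ ≤ b → ∑ i, (y i) ^ 2 ≤ N * b ^ 2 := by
    intro y b hy
    calc ∑ i, (y i) ^ 2 ≤ ∑ _i : Fin N, b ^ 2 := by
          apply Finset.sum_le_sum
          intro i _
          have := norm_le_pi_norm y i
          rw [Real.norm_eq_abs] at this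
          exact sq_le_sq' (by linarith [neg_abs_le (y i)]) (by linarith [le_abs_self (y i)])
      _ = N * b ^ 2 := by simp
  have hsum_ge : ∀ (y : Fin N → ℝ), 1 ≤ ‖y‖ → 1 ≤ ∑ i, (y i) ^ 2 := by
    intro y hy
    obtain ⟨i, hi⟩ : ∃ i, 1 ≤ ‖y i‖ := by
      by_contra hc
      push Not at hc
      linarith [(pi_norm_lt_iff one_pos).2 hc]
    have h1 : (y i) ^ 2 ≤ ∑ i, (y i) ^ 2 :=
      Finset.single_le_sum (f := fun i => (y i) ^ 2) (fun i _ => sq_nonneg _) (Finset.mem_univ i)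
    rw [Real.norm_eq_abs] at hi
    have : 1 ≤ (y i) ^ 2 := by rw [← sq_abs]; nlinarith
    linarith
  set V := (MeasureTheory.volume : MeasureTheory.Measure (Fin N → ℝ)).real
    (closedBall (0 : Fin N → ℝ) 4) with hV
  set V' := (MeasureTheory.volume : MeasureTheory.Measure (Fin N → ℝ)).real
    (closedBall (0 : Fin N → ℝ) (1 / (2 * N))) with hV'
  have hV'pos : 0 < V' := by
    rw [hV', MeasureTheory.Measure.real]
    apply ENNReal.toReal_pos
    · exact (measure_closedBall_pos _ _ (by positivity)).ne'
    · exact (isCompact_closedBall _ _).measure_lt_top.ne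
  have key : ∀ k : ℕ, q' ^ k * V' ≤ (C * q ^ k) * V := by
    intro k
    have hB := big_pert w hw (fun x hx => hsupp x hx.le) κ k
    have hlow : q' ^ k * V' ≤ ∫ x in closedBall (0 : Fin N → ℝ) 4, (1 - κ * ∑ i, (x i) ^ 2) ^ k := by
      have hcont : Continuous fun x : Fin N → ℝ => (1 - κ * ∑ i, (x i) ^ 2) ^ k := by fun_prop
      have hsub : closedBall (0 : Fin N → ℝ) (1 / (2 * N)) ⊆ closedBall 0 4 := by
        apply closedBall_subset_closedBall
        rw [div_le_iff₀ (by positivity)]; linarith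
      calc q' ^ k * V' = ∫ x in closedBall (0 : Fin N → ℝ) (1 / (2 * N)), q' ^ k := by
            rw [MeasureTheory.setIntegral_const, smul_eq_mul, mul_comm]
        _ ≤ ∫ x in closedBall (0 : Fin N → ℝ) (1 / (2 * N)), (1 - κ * ∑ i, (x i) ^ 2) ^ k := by
            apply MeasureTheory.setIntegral_mono_on
            · exact continuous_const.continuousOn.integrableOn_compact (isCompact_closedBall _ _)
            · exact hcont.continuousOn.integrableOn_compact (isCompact_closedBall _ _)
            · exact measurableSet_closedBall
            · intro x hx
              apply pow_le_pow_left₀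
              · rw [hq']; linarith
              · have h1 := hsum_le x _ (mem_closedBall_zero_iff.1 hx)
                have h2 : (N : ℝ) * (1 / (2 * N)) ^ 2 ≤ 1 / 4 := by
                  have : (N : ℝ) * (1 / (2 * N)) ^ 2 = 1 / (4 * N) := by field_simp; norm_num
                  rw [this, div_le_div_iff₀ (by positivity) (by norm_num)]
                  linarith
                rw [hq']
                nlinarith
        _ ≤ _ := by
            apply MeasureTheory.setIntegral_mono_set
            · exact hcont.continuousOn.integrableOn_compact (isCompact_closedBall _ _)
            · rw [Filter.EventuallyLE, MeasureTheory.ae_restrict_iff' measurableSet_closedBall]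
              refine Filter.Eventually.of_forall fun x hx => ?_
              apply pow_nonneg
              have h1 := hsum_le x 4 (by simpa using hx)
              nlinarith
            · exact hsub.eventuallyLE
    have hup : ∫ x in closedBall (0 : Fin N → ℝ) 4,
        D x * (1 - κ * ∑ i, ((x + w x) i) ^ 2) ^ k ≤ (C * q ^ k) * V := by
      refine (le_abs_self _).trans ?_
      rw [← Real.norm_eq_abs]
      apply MeasureTheory.norm_setIntegral_le_of_norm_le_const
        (isCompact_closedBall _ _).measure_lt_top
      intro x hx
      have hx4 : ‖x‖ ≤ 4 := by simpa using hx
      have hq0 : 0 ≤ q := by rw [hq]; linarith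
      have hC0 : 0 ≤ C := (norm_nonneg _).trans (hC x hx)
      rcases lt_or_ge ‖x‖ 2 with h2 | h2
      · rw [hD0 x h2]; simp; positivity
      · rw [norm_mul]
        apply mul_le_mul (hC x hx) _ (norm_nonneg _) hC0
        have hn1 : 1 ≤ ‖x + w x‖ := by
          have := norm_sub_le (x + w x) (w x)
          have h5 := hwn x
          rw [add_sub_cancel_right] at this
          linarith
        have hn4 : ‖x + w x‖ ≤ 4 := by
          rcases le_total 3 ‖x‖ with h3 | h3
          · rw [hsupp x h3, add_zero]; exact hx4
          · have := norm_add_le x (w x)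
            have := hwn x
            linarith
        have h6 := hsum_ge _ hn1
        have h7 := hsum_le _ _ hn4
        have h8 : 0 ≤ 1 - κ * ∑ i, ((x + w x) i) ^ 2 := by nlinarith
        rw [norm_pow, Real.norm_eq_abs, abs_of_nonneg h8]
        apply pow_le_pow_left₀ h8
        rw [hq]; nlinarith
    rw [hB] at hup
    exact hlow.trans hup
  have hq'pos : 0 < q' := by rw [hq']; linarith
  have hlim : Filter.Tendsto (fun k : ℕ => (C * V) * (q / q') ^ k) Filter.atTop (nhds ((C * V) * 0)) := by
    apply Filter.Tendsto.const_mul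
    apply tendsto_pow_atTop_nhds_zero_of_lt_one
    · apply div_nonneg _ hq'pos.le; rw [hq]; linarith
    · rw [div_lt_one hq'pos, hq, hq']; linarith
  rw [mul_zero] at hlim
  have := ge_of_tendsto' hlim (b := V') (fun k => by
    have hk := key k
    rw [div_pow, ← mul_div_assoc, le_div_iff₀ (by positivity)]
    linarith)
  linarith

/-- A continuous map from `ℝ^N` to `ℝ^n`, `n < N`, has a large fibre in the unit ball. -/
theorem big_fibre {n N : ℕ} (hn : n < N) (f : (Fin N → ℝ) → (Fin n → ℝ)) (hf : Continuous f) :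
    ∃ a b : Fin N → ℝ, ‖a‖ ≤ 3 ∧ ‖b‖ ≤ 3 ∧ f a = f b ∧ 1 / 2 ≤ ‖a - b‖ := by
  by_contra hcon
  push Not at hcon
  set K := closedBall (0 : Fin N → ℝ) 3 with hK
  have hKc : IsCompact K := isCompact_closedBall _ _
  have hKK : IsCompact {z : (Fin N → ℝ) × (Fin N → ℝ) | z ∈ K ×ˢ K ∧ 1 / 2 ≤ ‖z.1 - z.2‖} := by
    apply (hKc.prod hKc).inter_right
    exact isClosed_le (f := fun _ : (Fin N → ℝ) × (Fin N → ℝ) => (1 / 2 : ℝ))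
      (g := fun z : (Fin N → ℝ) × (Fin N → ℝ) => ‖z.1 - z.2‖) continuous_const (by fun_prop)
  -- uniform separation
  obtain ⟨η, hη, hsep⟩ : ∃ η > 0, ∀ x ∈ K, ∀ y ∈ K, ‖f x - f y‖ < η → ‖x - y‖ < 1 / 2 := by
    by_cases hemp : {z : (Fin N → ℝ) × (Fin N → ℝ) | z ∈ K ×ˢ K ∧ 1 / 2 ≤ ‖z.1 - z.2‖}.Nonempty
    · obtain ⟨z, hz, hmin⟩ := hKK.exists_isMinOn hemp (f := fun z => ‖f z.1 - f z.2‖)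
        (by fun_prop)
      refine ⟨‖f z.1 - f z.2‖, ?_, ?_⟩
      · rw [gt_iff_lt, norm_pos_iff, sub_ne_zero]
        intro he
        have := hcon z.1 z.2 (by simpa [hK] using hz.1.1) (by simpa [hK] using hz.1.2) he
        linarith [hz.2]
      · intro x hx y hy hlt
        by_contra hc
        push Not at hc
        have := hmin (show (x, y) ∈ _ from ⟨⟨hx, hy⟩, hc⟩)
        simp only [mem_ofPred_eq] at this
        linarith
    · refine ⟨1, one_pos, fun x hx y hy _ => ?_⟩
      by_contra hc
      push Not at hc
      exact hemp ⟨(x, y), ⟨hx, hy⟩, hc⟩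
  obtain ⟨F, hF, -⟩ := hf.exists_contMDiff_approx (modelWithCornersSelf ℝ (Fin N → ℝ)) 1
    (ε := fun _ => η / 4) continuous_const (fun _ => by positivity)
  have hFs : ContDiff ℝ 1 F := by
    have := F.contMDiff
    exact this.contDiff
  obtain ⟨G, hG⟩ := exists_contMDiffMap_forall_mem_convex_of_local_const
    (modelWithCornersSelf ℝ (Fin n → ℝ)) (n := 1) (F := Fin N → ℝ)
    (t := fun y => {c : Fin N → ℝ | ∀ x ∈ K, F x = y → c ∈ closedBall x (1 / 2)})
    (by
      intro y
      have : {c : Fin N → ℝ | ∀ x ∈ K, F x = y → c ∈ closedBall x (1 / 2)} =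
          ⋂ x ∈ K, ⋂ _ : F x = y, closedBall x (1 / 2) := by
        ext; simp
      rw [this]
      exact convex_iInter fun x => convex_iInter fun _ => convex_iInter fun _ =>
        convex_closedBall _ _)
    (by
      intro y
      by_cases hy : ∃ x ∈ K, ‖F x - y‖ < η / 4
      · obtain ⟨x₀, hx₀, hlt⟩ := hy
        refine ⟨x₀, ?_⟩
        have : ball y (η / 4) ∈ nhds y := ball_mem_nhds _ (by positivity)
        filter_upwards [this] with y' hy' x hx hxy
        rw [mem_ball, dist_eq_norm] at hy'
        rw [mem_closedBall, dist_eq_norm]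
        refine (hsep x₀ hx₀ x hx ?_).le
        have e1 := hF x₀
        have e2 := hF x
        rw [dist_eq_norm] at e1 e2
        have : f x₀ - f x = -(F x₀ - f x₀) + (F x₀ - y) - (y' - y) + (F x - f x) := by
          rw [hxy]; abel
        rw [this]
        calc _ ≤ ‖-(F x₀ - f x₀) + (F x₀ - y) - (y' - y)‖ + ‖F x - f x‖ := norm_add_le _ _
          _ ≤ ‖-(F x₀ - f x₀) + (F x₀ - y)‖ + ‖y' - y‖ + ‖F x - f x‖ := by
            gcongr; exact norm_sub_le _ _
          _ ≤ ‖-(F x₀ - f x₀)‖ + ‖F x₀ - y‖ + ‖y' - y‖ + ‖F x - f x‖ := by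
            gcongr; exact norm_add_le _ _
          _ < η := by rw [norm_neg]; linarith
      · push Not at hy
        refine ⟨0, ?_⟩
        have : ball y (η / 4) ∈ nhds y := ball_mem_nhds _ (by positivity)
        filter_upwards [this] with y' hy' x hx hxy
        rw [mem_ball, dist_eq_norm] at hy'
        have := hy x hx
        rw [hxy] at this
        linarith)
  have hGs : ContDiff ℝ 1 G := by
    have := G.contMDiff
    exact this.contDiff
  refine no_degenerate (by omega) (fun x => G (F x)) (hGs.comp hFs) ?_ ?_
  · intro x hx
    have := hG (F x) x (by simpa [hK] using hx) rfl
    rw [mem_closedBall, dist_eq_norm] at this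
    linarith
  · intro x
    have hd : fderiv ℝ (fun x => G (F x)) x = (fderiv ℝ G (F x)).comp (fderiv ℝ F x) :=
      fderiv_comp x ((hGs.differentiable one_ne_zero) _) ((hFs.differentiable one_ne_zero) _)
    rw [hd, ContinuousLinearMap.det, LinearMap.det_eq_zero_iff_ker_ne_bot]
    have hker : (fderiv ℝ F x : (Fin N → ℝ) →ₗ[ℝ] (Fin n → ℝ)).ker ≠ ⊥ := by
      apply LinearMap.ker_ne_bot_of_finrank_lt
      simpa using hn
    intro hbot
    apply hker
    rw [eq_bot_iff, ← hbot]
    intro v hv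
    rw [LinearMap.mem_ker] at hv ⊢
    simp only [ContinuousLinearMap.coe_coe] at hv
    simp [hv]

end WQ

namespace WQ

theorem babenko_lower {B : Type*} [NormedAddCommGroup B] (X : Set B) {n N : ℕ} (hn : n < N)
    (hbdd : Bornology.IsBounded X) (Ψ : (Fin N → ℝ) → B) (hΨ : Continuous Ψ)
    (hmem : ∀ a, ‖a‖ ≤ 1 → Ψ a ∈ X) (e : ℝ) (he : 0 ≤ e)
    (hexp : ∀ a b, e * ‖a - b‖ ≤ ‖Ψ a - Ψ b‖) : e / 6 ≤ babenkoWidth n X := by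
  apply le_csInf
  · exact ⟨_, fun _ => 0, continuous_const, rfl⟩
  · rintro d ⟨p, hp, rfl⟩
    let cl : (Fin N → ℝ) → (Fin N → ℝ) := fun x i => max (-1) (min 1 (x i / 3))
    have hclc : Continuous cl := by fun_prop
    have hcln : ∀ x, ‖cl x‖ ≤ 1 := by
      intro x
      rw [pi_norm_le_iff_of_nonneg zero_le_one]
      intro i
      rw [Real.norm_eq_abs, abs_le]
      exact ⟨le_max_left _ _, max_le (by norm_num) (min_le_left _ _)⟩
    have hcle : ∀ x, ‖x‖ ≤ 3 → cl x = (1 / 3 : ℝ) • x := by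
      intro x hx
      ext i
      have := (norm_le_pi_norm x i).trans hx
      rw [Real.norm_eq_abs, abs_le] at this
      simp only [cl, Pi.smul_apply, smul_eq_mul]
      rw [min_eq_right (by linarith [this.2]), max_eq_right (by linarith [this.1])]
      ring
    let q : (Fin N → ℝ) → X := fun x => ⟨Ψ (cl x), hmem _ (hcln x)⟩
    have hq : Continuous q := (hΨ.comp hclc).subtype_mk _
    obtain ⟨a, b, ha, hb, hab, hdist⟩ := big_fibre hn (fun x => p (q x)) (hp.comp hq)
    have hb1 : ∀ S : Set X, Bornology.IsBounded (Subtype.val '' S) := fun S =>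
      hbdd.subset (by rintro _ ⟨y, _, rfl⟩; exact y.2)
    have hbd : BddAbove (range fun x : X => diam (Subtype.val '' (p ⁻¹' {p x}))) := by
      refine ⟨diam X, ?_⟩
      rintro _ ⟨x, rfl⟩
      exact diam_mono (by rintro _ ⟨y, _, rfl⟩; exact y.2) hbdd
    refine le_trans ?_ (le_ciSup hbd (q a))
    have h1 : dist ((q a : X) : B) ((q b : X) : B) ≤ diam (Subtype.val '' (p ⁻¹' {p (q a)})) := by
      apply dist_le_diam_of_mem (hb1 _)
      · exact ⟨q a, rfl, rfl⟩
      · exact ⟨q b, hab.symm, rfl⟩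
    refine le_trans ?_ h1
    rw [dist_eq_norm]
    refine le_trans ?_ (hexp (cl a) (cl b))
    rw [hcle a ha, hcle b hb, ← smul_sub, norm_smul]
    norm_num
    nlinarith

theorem kolm_lower {K : Type*} [TopologicalSpace K] [CompactSpace K] (X : Set C(K, ℝ)) {n N : ℕ}
    (hn : n < N) (hbdd : Bornology.IsBounded X) (c : Fin N → K) (e : ℝ)
    (hX : ∀ a : Fin N → ℝ, ‖a‖ ≤ 1 → ∃ g ∈ X, ∀ i, g (c i) = e * a i) :
    e ≤ kolmogorovWidth n X := by
  apply le_csInf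
  · refine ⟨_, ⊥, inferInstance, ?_, rfl⟩
    simp
  · rintro d ⟨L, hL, hLn, rfl⟩
    let E : L →ₗ[ℝ] (Fin N → ℝ) :=
      { toFun := fun u i => (u : C(K, ℝ)) (c i)
        map_add' := fun u v => by ext; simp
        map_smul' := fun u v => by ext; simp }
    have hlt : LinearMap.range E < ⊤ := by
      rw [lt_top_iff_ne_top]
      intro htop
      have h1 := LinearMap.finrank_range_le E
      rw [htop, finrank_top] at h1
      simp at h1
      omega
    obtain ⟨f, hf0, hf⟩ := Submodule.exists_le_ker_of_lt_top _ hlt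
    let lam : Fin N → ℝ := fun i => f (Pi.single i 1)
    have hfl : ∀ y, f y = ∑ i, y i * lam i := by
      intro y
      conv_lhs => rw [pi_eq_sum_univ' y]
      simp [lam]
    have hpos : 0 < ∑ i, |lam i| := by
      apply lt_of_le_of_ne (Finset.sum_nonneg fun _ _ => abs_nonneg _)
      intro h0
      apply hf0
      ext i
      have := (Finset.sum_eq_zero_iff_of_nonneg (fun i _ => abs_nonneg (lam i))).1 h0.symm i
        (Finset.mem_univ i)
      simpa [lam] using this
    obtain ⟨g, hg, hgc⟩ := hX (fun i => (SignType.sign (lam i) : ℝ)) (by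
      rw [pi_norm_le_iff_of_nonneg zero_le_one]
      intro i
      rcases lt_trichotomy (lam i) 0 with h | h | h <;> simp [h])
    have hub : ∀ u : L, e ≤ ‖g - (u : C(K, ℝ))‖ := by
      intro u
      have h1 : f (E u) = 0 := hf (LinearMap.mem_range_self E u)
      have h2 : ∑ i, (g (c i) - (u : C(K, ℝ)) (c i)) * lam i = e * ∑ i, |lam i| := by
        simp_rw [sub_mul, Finset.sum_sub_distrib]
        rw [hfl] at h1
        have h3 : ∑ i, (u : C(K, ℝ)) (c i) * lam i = 0 := h1
        rw [h3, sub_zero, Finset.mul_sum]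
        refine Finset.sum_congr rfl fun i _ => ?_
        rw [hgc i, mul_assoc, sign_mul_self]
      have h3 : ∑ i, (g (c i) - (u : C(K, ℝ)) (c i)) * lam i ≤
          ‖g - (u : C(K, ℝ))‖ * ∑ i, |lam i| := by
        rw [Finset.mul_sum]
        refine Finset.sum_le_sum fun i _ => ?_
        refine (le_abs_self _).trans ?_
        rw [abs_mul]
        exact mul_le_mul_of_nonneg_right ((g - (u : C(K, ℝ))).norm_coe_le_norm (c i)) (abs_nonneg _)
      rw [h2] at h3
      exact le_of_mul_le_mul_right h3 hpos
    have hbd : BddAbove (range fun x : X => ⨅ u : L, ‖(x : C(K, ℝ)) - (u : C(K, ℝ))‖) := by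
      obtain ⟨R, hR⟩ := hbdd.exists_norm_le
      refine ⟨R, ?_⟩
      rintro _ ⟨x, rfl⟩
      refine (ciInf_le ⟨0, ?_⟩ (0 : L)).trans ?_
      · rintro _ ⟨u, rfl⟩; exact norm_nonneg _
      · simpa using hR x x.2
    refine le_trans ?_ (le_ciSup hbd ⟨g, hg⟩)
    exact le_ciInf hub

theorem kolm_upper {B : Type*} [NormedAddCommGroup B] [NormedSpace ℝ B] (X : Set B) {n : ℕ}
    (L : Submodule ℝ B) [FiniteDimensional ℝ L] (hLn : Module.finrank ℝ L ≤ n) (e : ℝ) (he : 0 ≤ e)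
    (h : ∀ x ∈ X, ∃ u ∈ L, ‖x - u‖ ≤ e) : kolmogorovWidth n X ≤ e := by
  unfold kolmogorovWidth
  refine csInf_le_of_le ⟨0, ?_⟩ ⟨L, inferInstance, hLn, rfl⟩ ?_
  · rintro d ⟨L', _, _, rfl⟩
    exact Real.iSup_nonneg fun x => Real.iInf_nonneg fun u => norm_nonneg _
  · apply Real.iSup_le _ he
    intro x
    obtain ⟨u, hu, hxu⟩ := h x x.2
    refine (ciInf_le ⟨0, ?_⟩ (⟨u, hu⟩ : L)).trans hxu
    rintro _ ⟨u, rfl⟩; exact norm_nonneg _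

theorem babenko_upper {B : Type*} [NormedAddCommGroup B] [NormedSpace ℝ B] (X : Set B) {n : ℕ}
    (L : Submodule ℝ B) [FiniteDimensional ℝ L] (hLn : Module.finrank ℝ L ≤ n) (e : ℝ) (he : 0 < e)
    (h : ∀ x ∈ X, ∃ u ∈ L, ‖x - u‖ ≤ e) : babenkoWidth n X ≤ 4 * e := by
  obtain ⟨A, hA⟩ := exists_continuous_forall_mem_convex_of_local_const (X := X) (E := L)
    (t := fun x => {u : L | ‖(x : B) - (u : B)‖ < 2 * e})
    (by
      intro x
      have : {u : L | ‖(x : B) - (u : B)‖ < 2 * e} = L.subtype ⁻¹' (ball (x : B) (2 * e)) := by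
        ext u
        simp [dist_eq_norm, norm_sub_rev]
      rw [this]
      exact (convex_ball _ _).linear_preimage _)
    (by
      intro x
      obtain ⟨u, hu, hxu⟩ := h x x.2
      refine ⟨⟨u, hu⟩, ?_⟩
      have hc : Continuous fun y : X => ‖(y : B) - u‖ := by fun_prop
      exact (hc.tendsto x).eventually (gt_mem_nhds (by linarith)))
  let m := Module.finrank ℝ L
  let φ : L ≃L[ℝ] (Fin m → ℝ) := ContinuousLinearEquiv.ofFinrankEq (by simp [m])
  let ι : (Fin m → ℝ) → (Fin n → ℝ) := fun y i => if hi : (i : ℕ) < m then y ⟨i, hi⟩ else 0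
  have hι : Continuous ι := by
    apply continuous_pi
    intro i
    by_cases hi : (i : ℕ) < m
    · simp only [ι, hi, dite_true]; fun_prop
    · simp only [ι, hi, dite_false]; fun_prop
  have hιi : Function.Injective ι := by
    intro y z hyz
    ext i
    have := congrFun hyz ⟨i, lt_of_lt_of_le i.2 hLn⟩
    simpa [ι] using this
  unfold babenkoWidth
  refine csInf_le_of_le ⟨0, ?_⟩ ⟨fun x => ι (φ (A x)), hι.comp (φ.continuous.comp A.continuous),
    rfl⟩ ?_
  · rintro d ⟨p, _, rfl⟩
    exact Real.iSup_nonneg fun x => diam_nonneg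
  · apply Real.iSup_le _ (by linarith)
    intro x
    apply diam_le_of_forall_dist_le (by linarith)
    rintro _ ⟨y, hy, rfl⟩ _ ⟨z, hz, rfl⟩
    have hy' : A y = A x := φ.injective (hιi hy)
    have hz' : A z = A x := φ.injective (hιi hz)
    have h1 := hA y
    have h2 := hA z
    simp only [mem_ofPred_eq] at h1 h2
    rw [hy'] at h1
    rw [hz'] at h2
    rw [dist_eq_norm]
    have : (y : B) - z = ((y : B) - A x) - (z - A x) := by abel
    rw [this]
    have := norm_sub_le ((y : B) - A x) (z - A x)
    linarith

theorem cover_approx {K : Type*} [TopologicalSpace K] [CompactSpace K] [T2Space K]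
    (X : Set C(K, ℝ)) {ι : Type*} [Fintype ι] (U : ι → Set K) (hU : ∀ i, IsOpen (U i))
    (hcov : ∀ x, ∃ i, x ∈ U i) (P : ι → Submodule ℝ C(K, ℝ)) [∀ i, FiniteDimensional ℝ (P i)]
    (D : ℕ) (hD : ∀ i, Module.finrank ℝ (P i) ≤ D) (e : ℝ) (he : 0 ≤ e)
    (h : ∀ g ∈ X, ∀ i, ∃ u ∈ P i, ∀ x ∈ U i, |g x - u x| ≤ e) :
    ∃ L : Submodule ℝ C(K, ℝ), FiniteDimensional ℝ L ∧ Module.finrank ℝ L ≤ Fintype.card ι * D ∧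
      ∀ g ∈ X, ∃ u ∈ L, ‖g - u‖ ≤ e := by
  obtain ⟨φ, hφ⟩ := PartitionOfUnity.exists_isSubordinate (s := (univ : Set K)) isClosed_univ U hU
    (by intro x _; simpa using hcov x)
  let Λ : (Π i, P i) →ₗ[ℝ] C(K, ℝ) :=
    { toFun := fun p => ∑ i, φ i * (p i : C(K, ℝ))
      map_add' := fun p q => by simp [mul_add, Finset.sum_add_distrib]
      map_smul' := fun c p => by simp [Finset.smul_sum] }
  refine ⟨LinearMap.range Λ, inferInstance, ?_, ?_⟩
  · refine (LinearMap.finrank_range_le Λ).trans ?_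
    rw [Module.finrank_pi_fintype]
    calc _ ≤ ∑ _i : ι, D := Finset.sum_le_sum fun i _ => hD i
      _ = _ := by simp
  · intro g hg
    choose u hu hue using h g hg
    refine ⟨_, LinearMap.mem_range_self Λ fun i => ⟨u i, hu i⟩, ?_⟩
    rw [ContinuousMap.norm_le _ he]
    intro x
    have hs : ∑ i, φ i x = 1 := by
      rw [← finsum_eq_sum_of_fintype]
      exact φ.sum_eq_one (mem_univ x)
    have : (g - Λ fun i => ⟨u i, hu i⟩) x = ∑ i, φ i x * (g x - u i x) := by
      simp only [ContinuousMap.sub_apply, Λ, LinearMap.coe_mk, AddHom.coe_mk,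
        ContinuousMap.sum_apply, ContinuousMap.mul_apply, mul_sub, Finset.sum_sub_distrib]
      rw [← Finset.sum_mul, hs, one_mul]
    rw [this]
    calc ‖∑ i, φ i x * (g x - u i x)‖ ≤ ∑ i, ‖φ i x * (g x - u i x)‖ := norm_sum_le _ _
      _ ≤ ∑ i, φ i x * e := by
          refine Finset.sum_le_sum fun i _ => ?_
          rw [norm_mul, Real.norm_eq_abs, abs_of_nonneg (φ.nonneg i x)]
          by_cases h0 : φ i x = 0
          · simp [h0]
          · apply mul_le_mul_of_nonneg_left _ (φ.nonneg i x)
            exact hue i x (hφ i (subset_closure h0))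
      _ = e := by rw [← Finset.sum_mul, hs, one_mul]

end WQ

namespace WQ

/-- open cube -/
def ocube (l : ℕ) (T : ℝ) : Set (Fin l → ℝ) := {x | ∀ i, 0 < x i ∧ x i < T}

lemma ocube_eq (l : ℕ) (T : ℝ) : ocube l T = Set.pi Set.univ fun _ => Set.Ioo 0 T := by
  ext x; simp [ocube, Set.mem_pi]

lemma isOpen_ocube (l : ℕ) (T : ℝ) : IsOpen (ocube l T) := by
  rw [ocube_eq]; exact isOpen_set_pi Set.finite_univ (fun _ _ => isOpen_Ioo)

lemma rho_le {l : ℕ} (t : Fin l → ℝ) (i : Fin l) : rho t ≤ |t i| :=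
  ciInf_le (Set.finite_range _).bddBelow i

lemma le_rho {l : ℕ} (hl : 2 ≤ l) (t : Fin l → ℝ) {b : ℝ} (h : ∀ i, b ≤ |t i|) : b ≤ rho t := by
  have : Nonempty (Fin l) := ⟨⟨0, by omega⟩⟩
  exact le_ciInf h

lemma exists_rho_eq {l : ℕ} (hl : 2 ≤ l) (t : Fin l → ℝ) : ∃ i, |t i| = rho t := by
  have : Nonempty (Fin l) := ⟨⟨0, by omega⟩⟩
  exact exists_eq_ciInf_of_finite

lemma rho_pos_iff {l : ℕ} (hl : 2 ≤ l) (t : Fin l → ℝ) : 0 < rho t ↔ ∀ i, t i ≠ 0 := by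
  constructor
  · intro h i
    exact abs_pos.1 (h.trans_le (rho_le t i))
  · intro h
    obtain ⟨i, hi⟩ := exists_rho_eq hl t
    rw [← hi]; exact abs_pos.2 (h i)

lemma pcube_eq {l : ℕ} (hl : 2 ≤ l) (T : ℝ) : {t ∈ cube l T | 0 < rho t} =
    Set.pi Set.univ fun _ => Set.Ioc 0 T := by
  ext t
  simp only [mem_ofPred_eq, cube, Set.mem_pi, mem_univ, true_implies, rho_pos_iff hl, mem_Icc, mem_Ioc]
  constructor
  · rintro ⟨h1, h2⟩ i
    exact ⟨lt_of_le_of_ne (h1 i).1 (Ne.symm (h2 i)), (h1 i).2⟩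
  · intro h
    exact ⟨fun i => ⟨(h i).1.le, (h i).2⟩, fun i => (h i).1.ne'⟩

lemma pcube_nhds {l : ℕ} (hl : 2 ≤ l) (T : ℝ) {x : Fin l → ℝ} (hx : x ∈ ocube l T) :
    {t ∈ cube l T | 0 < rho t} ∈ nhds x := by
  refine Filter.mem_of_superset ((isOpen_ocube l T).mem_nhds hx) ?_
  rw [pcube_eq hl]
  intro y hy i _
  exact ⟨(hy i).1, (hy i).2.le⟩

lemma pcube_uniqueDiff {l : ℕ} (hl : 2 ≤ l) (T : ℝ) :
    UniqueDiffOn ℝ {t ∈ cube l T | 0 < rho t} := by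
  rw [pcube_eq hl]
  exact UniqueDiffOn.univ_pi fun _ => uniqueDiffOn_Ioc _ _

lemma interior_info {l : ℕ} (hl : 2 ≤ l) {T M ζ γ : ℝ} {r s : ℕ} (hrs : r < s)
    (hg : (s : ℝ) - r - ζ = γ)
    {f : (Fin l → ℝ) → ℝ} (hf : MemQStarMulti l T M r s ζ f) {x : Fin l → ℝ} (hx : x ∈ ocube l T) :
    ContDiffAt ℝ s f x ∧ ∀ m : Fin s → Fin l,
      |iteratedFDeriv ℝ s f x (fun j => Pi.single (m j) 1)| ≤ M * rho x ^ (-γ) := by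
  obtain ⟨_, h2, _, h4⟩ := hf
  have hc : ContDiffAt ℝ s f x := h2.contDiffAt (pcube_nhds hl T hx)
  refine ⟨hc, fun m => ?_⟩
  have hxP := mem_of_mem_nhds (pcube_nhds hl T hx)
  have := h4 s hrs le_rfl m x hxP
  rwa [iteratedFDerivWithin_eq_iteratedFDeriv (pcube_uniqueDiff hl T) hc hxP, hg] at this

lemma multilin_bound {l s : ℕ} (Φ : ContinuousMultilinearMap ℝ (fun _ : Fin s => Fin l → ℝ) ℝ) {K : ℝ}
    (h : ∀ m : Fin s → Fin l, |Φ (fun j => Pi.single (m j) 1)| ≤ K) (y : Fin l → ℝ) :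
    |Φ (fun _ => y)| ≤ K * l ^ s * ‖y‖ ^ s := by
  have hy : y = ∑ i, y i • (Pi.single i (1:ℝ) : Fin l → ℝ) := by
    ext k; simp [Finset.sum_apply, Pi.single_apply]
  have h1 : Φ (fun _ => y) = ∑ m : Fin s → Fin l, (∏ j, y (m j)) * Φ (fun j => Pi.single (m j) 1) := by
    conv_lhs => rw [hy]
    rw [ContinuousMultilinearMap.map_sum]
    refine Finset.sum_congr rfl fun m _ => ?_
    rw [ContinuousMultilinearMap.map_smul_univ]; rfl
  rw [h1]
  refine (Finset.abs_sum_le_sum_abs _ _).trans ?_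
  have : ∀ m ∈ (Finset.univ : Finset (Fin s → Fin l)),
      |(∏ j, y (m j)) * Φ (fun j => Pi.single (m j) 1)| ≤ ‖y‖ ^ s * K := by
    intro m _
    rw [abs_mul]
    refine mul_le_mul ?_ (h m) (abs_nonneg _) (by positivity)
    rw [Finset.abs_prod]
    calc ∏ j, |y (m j)| ≤ ∏ _j : Fin s, ‖y‖ :=
          Finset.prod_le_prod (fun _ _ => abs_nonneg _) (fun j _ => norm_le_pi_norm y (m j))
      _ = ‖y‖ ^ s := by simp
  refine (Finset.sum_le_sum this).trans (le_of_eq ?_)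
  simp; ring

lemma seg_ocube {l : ℕ} {T : ℝ} {c x : Fin l → ℝ} (hc : c ∈ ocube l T) (hx : x ∈ cube l T)
    {τ : ℝ} (h0 : 0 ≤ τ) (h1 : τ < 1) : c + τ • (x - c) ∈ ocube l T := by
  intro i
  have := hc i
  have hxi : x i ∈ Icc 0 T := hx i (mem_univ i)
  simp only [Pi.add_apply, Pi.smul_apply, Pi.sub_apply, smul_eq_mul]
  constructor
  · nlinarith [hxi.1]
  · nlinarith [hxi.2]

lemma rho_seg {l : ℕ} (hl : 2 ≤ l) {T : ℝ} {c x : Fin l → ℝ} (hc : c ∈ ocube l T) (hx : x ∈ cube l T)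
    {τ : ℝ} (h0 : 0 ≤ τ) (h1 : τ ≤ 1) : (1 - τ) * rho c ≤ rho (c + τ • (x - c)) := by
  refine le_rho hl _ fun i => ?_
  have hxi : x i ∈ Icc 0 T := hx i (mem_univ i)
  have h2 : (1 - τ) * rho c ≤ (1 - τ) * c i := by
    refine mul_le_mul_of_nonneg_left ?_ (by linarith)
    have := rho_le c i
    rwa [abs_of_pos (hc i).1] at this
  refine h2.trans (le_trans ?_ (le_abs_self _))
  simp only [Pi.add_apply, Pi.smul_apply, Pi.sub_apply, smul_eq_mul]
  nlinarith [hxi.1]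

lemma taylor_bound_open {l : ℕ} (hl : 2 ≤ l) {T M ζ γ : ℝ} {r n : ℕ} (hM : 0 < M) (hrs : r < n + 1)
    (hn : 1 ≤ n) (hγn : γ ≤ n) (hγ : 0 < γ)
    (hg : ((n + 1 : ℕ) : ℝ) - r - ζ = γ)
    {f : (Fin l → ℝ) → ℝ} (hf : MemQStarMulti l T M r (n + 1) ζ f) {c x : Fin l → ℝ} (hc : c ∈ ocube l T)
    (hx : x ∈ ocube l T) :
    |f x - ∑ k ∈ Finset.range (n + 1), ((k.factorial : ℝ))⁻¹ * (iteratedFDeriv ℝ k f c (fun _ ↦ x - c))|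
      ≤ M * l ^ (n + 1) * ‖x - c‖ ^ (n + 1) * rho c ^ (-γ) := by
  have hxc : x ∈ cube l T := fun i _ => ⟨(hx i).1.le, (hx i).2.le⟩
  have hseg : ∀ τ ∈ Icc (0:ℝ) 1, c + τ • (x - c) ∈ ocube l T := by
    intro τ hτ
    rcases hτ.2.lt_or_eq with h | h
    · exact seg_ocube hc hxc hτ.1 h
    · subst h; simpa using hx
  have key := map_add_eq_sum_add_integral_iteratedFDeriv (f := f) (x := c) (y := x - c) (n := n)
    (fun τ hτ => by
      have := (interior_info hl hrs hg hf (hseg τ hτ)).1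
      exact_mod_cast this)
  have hρ : 0 < rho c := (rho_pos_iff hl c).2 fun i => (hc i).1.ne'
  rw [add_sub_cancel] at key
  simp only [smul_eq_mul] at key
  rw [key, add_sub_cancel_left, abs_mul]
  have hfac : |((n.factorial : ℝ))⁻¹| ≤ 1 := by
    rw [abs_of_nonneg (by positivity)]
    exact inv_le_one_of_one_le₀ (by exact_mod_cast n.factorial_pos)
  have hIntg : ‖∫ t in (0:ℝ)..1, (1 - t)^n * iteratedFDeriv ℝ (n + 1) f (c + t • (x - c)) (fun _ ↦ x - c)‖
      ≤ (M * l ^ (n + 1) * ‖x - c‖ ^ (n + 1) * rho c ^ (-γ)) * |(1:ℝ) - 0| := by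
    apply intervalIntegral.norm_integral_le_of_norm_le_const
    intro τ hτ
    rw [uIoc_of_le zero_le_one] at hτ
    have hτ' : τ ∈ Icc (0:ℝ) 1 := ⟨hτ.1.le, hτ.2⟩
    rw [norm_mul, Real.norm_eq_abs, Real.norm_eq_abs, abs_pow]
    rcases hτ.2.lt_or_eq with h | h
    · have h1τ : 0 < 1 - τ := by linarith
      rw [abs_of_pos h1τ]
      have hR := rho_seg hl hc hxc hτ.1.le hτ.2
      have hb := multilin_bound _ (interior_info hl hrs hg hf (hseg τ hτ')).2 (x - c)
      have hpow : rho (c + τ • (x - c)) ^ (-γ) ≤ ((1 - τ) * rho c) ^ (-γ) :=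
        Real.rpow_le_rpow_of_nonpos (by positivity) hR (by linarith)
      rw [Real.mul_rpow h1τ.le hρ.le] at hpow
      have h1 : (1 - τ) ^ n * (1 - τ) ^ (-γ) ≤ 1 := by
        rw [← Real.rpow_natCast, ← Real.rpow_add h1τ]
        exact Real.rpow_le_one h1τ.le (by linarith [hτ.1]) (by linarith)
      calc (1 - τ) ^ n * |(iteratedFDeriv ℝ (n + 1) f (c + τ • (x - c))) fun _ ↦ x - c|
          ≤ (1 - τ) ^ n * (M * ((1 - τ) ^ (-γ) * rho c ^ (-γ)) * l ^ (n + 1) * ‖x - c‖ ^ (n + 1)) := by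
            refine mul_le_mul_of_nonneg_left (hb.trans ?_) (by positivity)
            gcongr
        _ = ((1 - τ) ^ n * (1 - τ) ^ (-γ)) * (M * l ^ (n + 1) * ‖x - c‖ ^ (n + 1) * rho c ^ (-γ)) := by ring
        _ ≤ 1 * (M * l ^ (n + 1) * ‖x - c‖ ^ (n + 1) * rho c ^ (-γ)) := by
            refine mul_le_mul_of_nonneg_right h1 (by positivity)
        _ = _ := one_mul _
    · subst h
      rw [sub_self, abs_zero, zero_pow (by omega), zero_mul]
      positivity
  rw [sub_zero, abs_one, mul_one, Real.norm_eq_abs] at hIntg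
  calc _ ≤ 1 * _ := mul_le_mul hfac hIntg (abs_nonneg _) zero_le_one
    _ = _ := one_mul _

lemma taylor_bound {l : ℕ} (hl : 2 ≤ l) {T M ζ γ : ℝ} {r n : ℕ} (hM : 0 < M) (hrs : r < n + 1)
    (hn : 1 ≤ n) (hγn : γ ≤ n) (hγ : 0 < γ)
    (hg : ((n + 1 : ℕ) : ℝ) - r - ζ = γ)
    {f : (Fin l → ℝ) → ℝ} (hf : MemQStarMulti l T M r (n + 1) ζ f) {c x : Fin l → ℝ} (hc : c ∈ ocube l T)
    (hx : x ∈ cube l T) :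
    |f x - ∑ k ∈ Finset.range (n + 1), ((k.factorial : ℝ))⁻¹ * (iteratedFDeriv ℝ k f c (fun _ ↦ x - c))|
      ≤ M * l ^ (n + 1) * ‖x - c‖ ^ (n + 1) * rho c ^ (-γ) := by
  have hcont : ContinuousOn f (cube l T) := hf.1.continuousOn
  let p : ℝ → (Fin l → ℝ) := fun τ => c + τ • (x - c)
  have hp : Continuous p := by fun_prop
  have hp1 : p 1 = x := by simp [p]
  have hpm : ∀ τ ∈ Ico (0:ℝ) 1, p τ ∈ ocube l T := fun τ hτ => seg_ocube hc hx hτ.1 hτ.2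
  have hlim : Filter.Tendsto p (nhdsWithin 1 (Iio 1)) (nhdsWithin x (cube l T)) := by
    rw [tendsto_nhdsWithin_iff]
    constructor
    · have := hp.tendsto 1
      rw [hp1] at this
      exact this.mono_left nhdsWithin_le_nhds
    · filter_upwards [Ico_mem_nhdsLT (zero_lt_one (α := ℝ))] with τ hτ
      exact fun i _ => ⟨(hpm τ hτ i).1.le, (hpm τ hτ i).2.le⟩
  have hG : Filter.Tendsto (fun z => |f z - ∑ k ∈ Finset.range (n + 1), ((k.factorial : ℝ))⁻¹ *
      (iteratedFDeriv ℝ k f c (fun _ ↦ z - c))|) (nhdsWithin x (cube l T))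
      (nhds (|f x - ∑ k ∈ Finset.range (n + 1), ((k.factorial : ℝ))⁻¹ *
      (iteratedFDeriv ℝ k f c (fun _ ↦ x - c))|)) := by
    apply Filter.Tendsto.abs
    apply Filter.Tendsto.sub (hcont x hx)
    have : Continuous fun z : Fin l → ℝ => ∑ k ∈ Finset.range (n + 1), ((k.factorial : ℝ))⁻¹ *
      (iteratedFDeriv ℝ k f c (fun _ ↦ z - c)) := by fun_prop
    exact (this.tendsto x).mono_left nhdsWithin_le_nhds
  have hH : Filter.Tendsto (fun z => M * l ^ (n + 1) * ‖z - c‖ ^ (n + 1) * rho c ^ (-γ))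
      (nhdsWithin x (cube l T)) (nhds (M * l ^ (n + 1) * ‖x - c‖ ^ (n + 1) * rho c ^ (-γ))) := by
    have : Continuous fun z : Fin l → ℝ => M * l ^ (n + 1) * ‖z - c‖ ^ (n + 1) * rho c ^ (-γ) := by fun_prop
    exact (this.tendsto x).mono_left nhdsWithin_le_nhds
  refine le_of_tendsto_of_tendsto (hG.comp hlim) (hH.comp hlim) ?_
  filter_upwards [Ico_mem_nhdsLT (zero_lt_one (α := ℝ))] with τ hτ
  exact taylor_bound_open hl hM hrs hn hγn hγ hg hf hc (hpm τ hτ)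

end WQ

namespace WQ

/-- The counting sum. -/
noncomputable def SJ (p q : ℝ) (J : ℕ) : ℝ :=
  ∑ j ∈ Finset.range (J + 1), (2:ℝ) ^ ((j:ℝ) * p + ((J:ℝ) - j) * q)

/-- number of subdivisions in layer `j` -/
noncomputable def mU (β : ℝ) (J j : ℕ) : ℕ := ⌈(2:ℝ) ^ (((J:ℝ) - j) * β)⌉₊

lemma mU_pos (β : ℝ) (J j : ℕ) : 0 < mU β J j := Nat.ceil_pos.2 (by positivity)

lemma mU_ge (β : ℝ) (J j : ℕ) : (2:ℝ) ^ (((J:ℝ) - j) * β) ≤ mU β J j := Nat.le_ceil _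

lemma mU_le_two {β : ℝ} (hβ : 0 ≤ β) {J j : ℕ} (hj : j ≤ J) :
    (mU β J j : ℝ) ≤ 2 * (2:ℝ) ^ (((J:ℝ) - j) * β) := by
  have h1 : (1:ℝ) ≤ (2:ℝ) ^ (((J:ℝ) - j) * β) := by
    apply Real.one_le_rpow (by norm_num)
    have : (j:ℝ) ≤ J := by exact_mod_cast hj
    exact mul_nonneg (by linarith) hβ
  have := Nat.ceil_lt_add_one (a := (2:ℝ) ^ (((J:ℝ) - j) * β)) (by positivity)
  unfold mU
  linarith

lemma mU_le_pow {β : ℝ} (hβ : β ≤ 1) {J j : ℕ} (hj : j ≤ J) :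
    mU β J j ≤ 2 ^ (J - j) := by
  apply Nat.ceil_le.2
  have : (j:ℝ) ≤ J := by exact_mod_cast hj
  calc (2:ℝ) ^ (((J:ℝ) - j) * β) ≤ (2:ℝ) ^ (((J - j : ℕ) : ℝ)) := by
        apply Real.rpow_le_rpow_of_exponent_le (by norm_num)
        rw [Nat.cast_sub hj]
        nlinarith
    _ = _ := by rw [Real.rpow_natCast]; push_cast; rfl

/-- index type of the net -/
abbrev NetIdx (l : ℕ) (β : ℝ) (J : ℕ) : Type :=
  Σ j : Fin (J + 1), Σ i0 : Fin l, ∀ i : Fin l, Fin (if i = i0 then mU β J j + 1 else 2 ^ (j:ℕ) * mU β J j + 1)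

lemma netIdx_card {l : ℕ} (hl : 2 ≤ l) {β : ℝ} (hβ : 0 ≤ β) (J : ℕ) :
    (Fintype.card (NetIdx l β J) : ℝ) ≤ l * 4 ^ l * SJ (l - 1) (β * l) J := by
  have hl' : ((l - 1 : ℕ) : ℝ) = (l:ℝ) - 1 := by rw [Nat.cast_sub (by omega)]; simp
  have h1 : ∀ j : Fin (J + 1), ∀ i0 : Fin l,
      Fintype.card (∀ i : Fin l, Fin (if i = i0 then mU β J j + 1 else 2 ^ (j:ℕ) * mU β J j + 1))
      = (mU β J j + 1) * (2 ^ (j:ℕ) * mU β J j + 1) ^ (l - 1) := by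
    intro j i0
    rw [Fintype.card_pi]
    simp only [Fintype.card_fin]
    rw [← Finset.mul_prod_erase _ _ (Finset.mem_univ i0), if_pos rfl]
    congr 1
    rw [Finset.prod_congr rfl (g := fun _ => 2 ^ (j:ℕ) * mU β J j + 1)]
    · rw [Finset.prod_const, Finset.card_erase_of_mem (Finset.mem_univ _)]; simp
    · intro i hi
      rw [if_neg (Finset.ne_of_mem_erase hi)]
  rw [Fintype.card_sigma]
  simp only [Fintype.card_sigma, h1, Finset.sum_const, Finset.card_univ, Fintype.card_fin, smul_eq_mul]
  rw [Fin.sum_univ_eq_sum_range (fun j => l * ((mU β J j + 1) * (2 ^ (j:ℕ) * mU β J j + 1) ^ (l - 1))) (J + 1)]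
  unfold SJ
  push_cast
  rw [Finset.mul_sum]
  refine Finset.sum_le_sum fun j hj => ?_
  have hj' : j ≤ J := by simpa [Nat.lt_succ_iff] using hj
  rw [mul_assoc]
  refine mul_le_mul_of_nonneg_left ?_ (by positivity)
  set m : ℝ := ((mU β J j : ℕ) : ℝ) with hm
  have hm1 : 1 ≤ m := by rw [hm]; exact_mod_cast mU_pos β J j
  have h2j : (1:ℝ) ≤ 2 ^ j := one_le_pow₀ (by norm_num)
  set y : ℝ := (2:ℝ) ^ (((J:ℝ) - j) * β) with hy
  have hmy : m ≤ 2 * y := mU_le_two hβ hj'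
  have hypos : 0 < y := by positivity
  calc (m + 1) * (2 ^ j * m + 1) ^ (l - 1) ≤ (2 * m) * (2 * (2 ^ j * m)) ^ (l - 1) := by
        gcongr
        · linarith
        · nlinarith
    _ ≤ (2 * (2 * y)) * (2 * (2 ^ j * (2 * y))) ^ (l - 1) := by gcongr
    _ = (4 * y) * ((4 * y) * 2 ^ j) ^ (l - 1) := by ring_nf
    _ = 4 ^ l * (y ^ l * (2 ^ j) ^ (l - 1)) := by
        obtain ⟨k, rfl⟩ : ∃ k, l = k + 1 := ⟨l - 1, by omega⟩
        simp only [Nat.add_sub_cancel, mul_pow, pow_succ]; ring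
    _ = 4 ^ l * (2:ℝ) ^ ((j:ℝ) * ((l:ℝ) - 1) + ((J:ℝ) - j) * (β * l)) := by
        congr 1
        rw [Real.rpow_add (by norm_num), mul_comm]
        congr 1
        · rw [← hl', Real.rpow_mul (by norm_num), Real.rpow_natCast, Real.rpow_natCast]
        · rw [hy, ← Real.rpow_natCast, ← Real.rpow_mul (by norm_num)]
          congr 1; ring

/-- mesh -/
noncomputable def hU (T β : ℝ) (J j : ℕ) : ℝ := T / 2 ^ j / mU β J j

open Classical in
/-- centers -/
noncomputable def cU {l : ℕ} (T β : ℝ) (J : ℕ) (ι : NetIdx l β J) : Fin l → ℝ :=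
  if h : ∃ z ∈ ocube l T, T / 2 ^ ((ι.1:ℕ) + 1) ≤ rho z ∧ ∀ i, ⌊z i / hU T β J ι.1⌋₊ = (ι.2.2 i : ℕ)
  then h.choose else fun _ => T / 2

lemma cU_spec {l : ℕ} (hl : 2 ≤ l) {T : ℝ} (hT : 0 < T) (β : ℝ) (J : ℕ) (ι : NetIdx l β J) :
    cU T β J ι ∈ ocube l T ∧ T / 2 ^ ((ι.1:ℕ) + 1) ≤ rho (cU T β J ι) := by
  unfold cU
  split_ifs with h
  · exact ⟨h.choose_spec.1, h.choose_spec.2.1⟩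
  · refine ⟨fun i => ⟨by positivity, by linarith⟩, le_rho hl _ fun i => ?_⟩
    rw [abs_of_pos (by positivity), pow_succ]
    have : (1:ℝ) ≤ 2 ^ (ι.1:ℕ) := one_le_pow₀ (by norm_num)
    gcongr
    linarith

lemma abs_lt_of_floor_eq {x y h : ℝ} (hh : 0 < h) (hx : 0 ≤ x) (hy : 0 ≤ y) (hxy : ⌊x / h⌋₊ = ⌊y / h⌋₊) :
    |x - y| < h := by
  have hx' : 0 ≤ x / h := by positivity
  have hy' : 0 ≤ y / h := by positivity
  have a1 := Nat.floor_le hx'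
  have a2 := Nat.lt_floor_add_one (x / h)
  have b1 := Nat.floor_le hy'
  have b2 := Nat.lt_floor_add_one (y / h)
  rw [hxy] at a1 a2
  have h1 : |x / h - y / h| < 1 := by rw [abs_lt]; constructor <;> linarith
  rw [← sub_div, abs_div, abs_of_pos hh, div_lt_one hh] at h1
  exact h1

lemma net_cover {l : ℕ} (hl : 2 ≤ l) {T : ℝ} (hT : 0 < T) {β : ℝ} (hβ1 : β ≤ 1) (J : ℕ)
    {t : Fin l → ℝ} (ht : t ∈ cube l T) :
    ∃ ι : NetIdx l β J, ‖t - cU T β J ι‖ < 2 * hU T β J ι.1 := by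
  set δ : ℝ := T / 2 ^ (J + 1) with hδ
  have hδ0 : 0 < δ := by positivity
  have hδT : δ ≤ T / 2 := by
    rw [hδ, pow_succ]
    have : (1:ℝ) ≤ 2 ^ J := one_le_pow₀ (by norm_num)
    gcongr
    linarith
  let t' : Fin l → ℝ := fun i => min (max (t i) δ) (T - δ)
  have hti : ∀ i, t i ∈ Icc 0 T := fun i => ht i (mem_univ i)
  have ht'1 : ∀ i, δ ≤ t' i := fun i => le_min (le_max_right _ _) (by linarith)
  have ht'2 : ∀ i, t' i ≤ T - δ := fun i => min_le_right _ _
  have ht'3 : ∀ i, |t i - t' i| ≤ δ := by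
    intro i
    have := hti i
    simp only [t', min_def, max_def, abs_le]
    constructor <;> split_ifs <;> linarith [this.1, this.2]
  have ht'o : t' ∈ ocube l T := fun i => ⟨by linarith [ht'1 i], by linarith [ht'2 i]⟩
  have hρδ : δ ≤ rho t' := le_rho hl _ fun i => (ht'1 i).trans (le_abs_self _)
  have hex : ∃ j : ℕ, T / 2 ^ (j + 1) ≤ rho t' := ⟨J, hρδ⟩
  classical
  let j := Nat.find hex
  have hj1 : T / 2 ^ (j + 1) ≤ rho t' := Nat.find_spec hex
  have hjJ : j ≤ J := Nat.find_min' hex hρδ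
  obtain ⟨i0, hi0⟩ := exists_rho_eq hl t'
  have hj2 : t' i0 ≤ T / 2 ^ j := by
    rcases Nat.eq_zero_or_pos j with h | h
    · rw [h]; simp; linarith [ht'2 i0]
    · have := Nat.find_min hex (m := j - 1) (by omega)
      rw [Nat.sub_add_cancel h, not_le] at this
      rw [← hi0] at this
      exact (le_abs_self _).trans this.le
  set m := mU β J j with hm
  have hmpos : (0:ℝ) < m := by exact_mod_cast mU_pos β J j
  set h := hU T β J j with hh
  have hhdef : h = T / 2 ^ j / m := rfl
  have hpos : 0 < h := by rw [hhdef]; positivity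
  have hk1 : ⌊t' i0 / h⌋₊ < m + 1 := by
    apply Nat.lt_succ_of_le
    apply Nat.floor_le_of_le
    rw [div_le_iff₀ hpos, hhdef, mul_div_cancel₀ _ hmpos.ne']
    exact hj2
  have hk2 : ∀ i, ⌊t' i / h⌋₊ < 2 ^ j * m + 1 := by
    intro i
    apply Nat.lt_succ_of_le
    apply Nat.floor_le_of_le
    rw [div_le_iff₀ hpos, hhdef]
    push_cast
    rw [mul_assoc, mul_div_cancel₀ _ hmpos.ne', mul_div_cancel₀ _ (by positivity)]
    linarith [ht'2 i]
  have hk : ∀ i, ⌊t' i / h⌋₊ < if i = i0 then m + 1 else 2 ^ j * m + 1 := by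
    intro i
    split_ifs with hi
    · subst hi; exact hk1
    · exact hk2 i
  let ι : NetIdx l β J := ⟨⟨j, by omega⟩, i0, fun i => ⟨⌊t' i / h⌋₊, hk i⟩⟩
  refine ⟨ι, ?_⟩
  have hE : ∃ z ∈ ocube l T, T / 2 ^ ((ι.1:ℕ) + 1) ≤ rho z ∧
      ∀ i, ⌊z i / hU T β J ι.1⌋₊ = (ι.2.2 i : ℕ) := ⟨t', ht'o, hj1, fun i => rfl⟩
  have hc : cU T β J ι = hE.choose := by unfold cU; rw [dif_pos hE]
  have hδh : δ ≤ h / 2 := by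
    rw [hδ, hhdef, div_div, div_div]
    apply div_le_div_of_nonneg_left hT.le (by positivity)
    have : (m:ℝ) ≤ 2 ^ (J - j) := by exact_mod_cast mU_le_pow hβ1 hjJ
    calc (2:ℝ) ^ j * (m * 2) ≤ 2 ^ j * (2 ^ (J - j) * 2) := by gcongr
      _ = 2 ^ (J + 1) := by rw [← mul_assoc, ← pow_add, ← pow_succ]; congr 1; omega
  change _ < 2 * h
  rw [pi_norm_lt_iff (by positivity)]
  intro i
  rw [Pi.sub_apply, Real.norm_eq_abs, hc]
  have hs := hE.choose_spec
  have hfl : ⌊hE.choose i / h⌋₊ = ⌊t' i / h⌋₊ := hs.2.2 i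
  have h3 := abs_lt_of_floor_eq hpos (hδ0.le.trans (ht'1 i)) (hs.1 i).1.le hfl.symm
  calc |t i - hE.choose i| ≤ |t i - t' i| + |t' i - hE.choose i| := abs_sub_le _ _ _
    _ < 2 * h := by linarith [ht'3 i]

/-- the error of one ball -/
lemma net_error {l : ℕ} (hl : 2 ≤ l) {T : ℝ} (hT : 0 < T) {s : ℕ} (hs : 0 < s) {a γ : ℝ} (hγ : 0 < γ)
    (ha : (s:ℝ) - γ = a) (J : ℕ) (ι : NetIdx l (a / s) J) :
    (2 * hU T (a / s) J ι.1) ^ s * rho (cU T (a / s) J ι) ^ (-γ) ≤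
      ((2 * T) ^ s * (T / 2) ^ (-γ)) * (2:ℝ) ^ (-(J:ℝ) * a) := by
  set j : ℕ := (ι.1 : ℕ) with hj
  have hρ := (cU_spec hl hT (a / s) J ι).2
  have h1 : rho (cU T (a / s) J ι) ^ (-γ) ≤ (T / 2 ^ (j + 1)) ^ (-γ) :=
    Real.rpow_le_rpow_of_nonpos (by positivity) hρ (by linarith)
  have hm := mU_ge (a / s) J j
  have hm0 : (0:ℝ) < mU (a / s) J j := by exact_mod_cast mU_pos _ _ _
  have h2 : (T / 2 ^ (j + 1)) ^ (-γ) = (T / 2) ^ (-γ) * (2:ℝ) ^ ((j:ℝ) * γ) := by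
    rw [show T / 2 ^ (j + 1) = (T / 2) * (2:ℝ) ^ (-(j:ℝ)) by
      rw [Real.rpow_neg (by norm_num), Real.rpow_natCast, pow_succ]; field_simp]
    rw [Real.mul_rpow (by positivity) (by positivity), ← Real.rpow_mul (by norm_num)]
    congr 2; ring
  have h3 : (2 * hU T (a / s) J j) ≤ (2 * T) * (2:ℝ) ^ (-(j:ℝ) - (((J:ℝ) - j) * (a / s))) := by
    rw [Real.rpow_sub (by norm_num), Real.rpow_neg (by norm_num), Real.rpow_natCast]
    unfold hU
    calc 2 * (T / 2 ^ j / mU (a / s) J j) ≤ 2 * (T / 2 ^ j / (2:ℝ) ^ (((J:ℝ) - j) * (a / s))) := by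
          gcongr
      _ = _ := by field_simp
  have h0 : 0 ≤ 2 * hU T (a / s) J j := by unfold hU; positivity
  have hs' : (s:ℝ) ≠ 0 := by positivity
  calc (2 * hU T (a / s) J j) ^ s * rho (cU T (a / s) J ι) ^ (-γ)
      ≤ ((2 * T) * (2:ℝ) ^ (-(j:ℝ) - (((J:ℝ) - j) * (a / s)))) ^ s * ((T / 2) ^ (-γ) * (2:ℝ) ^ ((j:ℝ) * γ)) := by
        rw [← h2]
        gcongr
        exact Real.rpow_nonneg (le_trans (by positivity) hρ) _
    _ = ((2 * T) ^ s * (T / 2) ^ (-γ)) * (((2:ℝ) ^ (-(j:ℝ) - (((J:ℝ) - j) * (a / s)))) ^ s * (2:ℝ) ^ ((j:ℝ) * γ)) := by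
        rw [mul_pow]; ring
    _ = _ := by
        congr 1
        rw [← Real.rpow_natCast, ← Real.rpow_mul (by norm_num), ← Real.rpow_add (by norm_num)]
        congr 1
        field_simp
        rw [← ha]; ring

/-- coefficient space of polynomials -/
abbrev PolyDom (l s : ℕ) : Type :=
  ∀ k : Fin s, ContinuousMultilinearMap ℝ (fun _ : Fin k => Fin l → ℝ) ℝ

lemma finDim_cmm (l k : ℕ) :
    FiniteDimensional ℝ (ContinuousMultilinearMap ℝ (fun _ : Fin k => Fin l → ℝ) ℝ) := by
  let F : ContinuousMultilinearMap ℝ (fun _ : Fin k => Fin l → ℝ) ℝ →ₗ[ℝ]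
      MultilinearMap ℝ (fun _ : Fin k => Fin l → ℝ) ℝ :=
    { toFun := fun Φ => Φ.toMultilinearMap
      map_add' := fun _ _ => rfl
      map_smul' := fun _ _ => rfl }
  exact FiniteDimensional.of_injective F ContinuousMultilinearMap.toMultilinearMap_injective

lemma finDim_polyDom (l s : ℕ) : FiniteDimensional ℝ (PolyDom l s) := by
  have := fun k => finDim_cmm l k
  infer_instance

/-- polynomial with given Taylor coefficients -/
noncomputable def polyMap {l : ℕ} (s : ℕ) (T : ℝ) (c : Fin l → ℝ) :
    PolyDom l s →ₗ[ℝ] C(Fin l → Set.Icc (0:ℝ) T, ℝ) where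
  toFun Φ := ⟨fun t => ∑ k : Fin s, ((k:ℕ).factorial : ℝ)⁻¹ * Φ k (fun _ => (fun i => (t i : ℝ)) - c), by fun_prop⟩
  map_add' Φ Ψ := by
    ext t; simp [mul_add, Finset.sum_add_distrib]
  map_smul' b Φ := by
    ext t; simp only [Pi.smul_apply, _root_.smul_apply, smul_eq_mul, ContinuousMap.coe_mk,
      RingHom.id_apply, ContinuousMap.smul_apply, Finset.mul_sum]
    refine Finset.sum_congr rfl fun k _ => by ring

lemma ball_approx {l : ℕ} (hl : 2 ≤ l) {T M ζ γ a : ℝ} {r n' : ℕ} (hT : 0 < T) (hM : 0 < M) (hrs : r < n' + 1)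
    (hr : 1 ≤ r) (ha1 : 1 ≤ a) (hγ : 0 < γ) (ha : ((n' + 1 : ℕ):ℝ) - γ = a)
    (hg : ((n' + 1 : ℕ) : ℝ) - r - ζ = γ) (β : ℝ) (hβ : β = a / (n' + 1 : ℕ)) (J : ℕ)
    (f : (Fin l → ℝ) → ℝ) (hf : MemQStarMulti l T M r (n' + 1) ζ f) (ι : NetIdx l β J)
    (t : Fin l → Set.Icc (0:ℝ) T) (ht : ‖(fun i => (t i : ℝ)) - cU T β J ι‖ < 2 * hU T β J ι.1) :
    |f (fun i => (t i : ℝ)) - polyMap (n' + 1) T (cU T β J ι) (fun k => iteratedFDeriv ℝ k f (cU T β J ι)) t| ≤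
      (M * l ^ (n' + 1) * ((2 * T) ^ (n' + 1) * (T / 2) ^ (-γ))) * (2:ℝ) ^ (-(J:ℝ) * a) := by
  have hcs := cU_spec hl hT β J ι
  have hne : (2 * hU T β J ι.1) ^ (n' + 1) * rho (cU T β J ι) ^ (-γ) ≤
      ((2 * T) ^ (n' + 1) * (T / 2) ^ (-γ)) * (2:ℝ) ^ (-(J:ℝ) * a) := by
    subst hβ
    exact net_error hl hT (by omega) hγ ha J ι
  set c := cU T β J ι with hc
  have htc : (fun i => (t i : ℝ)) ∈ cube l T := fun i _ => (t i).2
  have hγn : γ ≤ n' := by push_cast at ha; linarith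
  have hb := taylor_bound hl hM hrs (by omega) hγn hγ hg hf hcs.1 htc
  have hpe : polyMap (n' + 1) T c (fun k => iteratedFDeriv ℝ k f c) t
      = ∑ k ∈ Finset.range (n' + 1), ((k.factorial : ℝ))⁻¹ * (iteratedFDeriv ℝ k f c
        (fun _ ↦ (fun i => (t i : ℝ)) - c)) := by
    rw [← Fin.sum_univ_eq_sum_range (fun k => ((k.factorial : ℝ))⁻¹ * (iteratedFDeriv ℝ k f c
        (fun _ ↦ (fun i => (t i : ℝ)) - c)))]
    rfl
  rw [hpe]
  refine hb.trans ?_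
  have hρ0 : 0 ≤ rho c ^ (-γ) := by
    apply Real.rpow_nonneg
    exact le_trans (by positivity) hcs.2
  calc M * l ^ (n' + 1) * ‖(fun i => (t i : ℝ)) - c‖ ^ (n' + 1) * rho c ^ (-γ)
      ≤ M * l ^ (n' + 1) * (2 * hU T β J ι.1) ^ (n' + 1) * rho c ^ (-γ) := by
        gcongr
    _ = M * l ^ (n' + 1) * ((2 * hU T β J ι.1) ^ (n' + 1) * rho c ^ (-γ)) := by ring
    _ ≤ M * l ^ (n' + 1) * (((2 * T) ^ (n' + 1) * (T / 2) ^ (-γ)) * (2:ℝ) ^ (-(J:ℝ) * a)) := by gcongr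
    _ = _ := by ring

lemma upper_main {l : ℕ} (hl : 2 ≤ l) {T M ζ γ a : ℝ} {r s : ℕ} (hT : 0 < T) (hM : 0 < M) (hrs : r < s)
    (hr : 1 ≤ r) (ha1 : 1 ≤ a) (hγ : 0 < γ) (ha : (s:ℝ) - γ = a)
    (hg : (s : ℝ) - r - ζ = γ)
    (X : Set C(Fin l → Set.Icc (0:ℝ) T, ℝ))
    (hX : X = { g : C(Fin l → Set.Icc (0:ℝ) T, ℝ) |
      ∃ f : (Fin l → ℝ) → ℝ, MemQStarMulti l T M r s ζ f ∧
        ∀ t : Fin l → Set.Icc (0:ℝ) T, g t = f fun i => (t i : ℝ) }) :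
    ∃ A C : ℝ, 0 < A ∧ 0 < C ∧ ∀ J n : ℕ, A * SJ (l - 1) (a / s * l) J ≤ n →
      kolmogorovWidth n X ≤ C * (2:ℝ) ^ (-(J:ℝ) * a) ∧ babenkoWidth n X ≤ C * (2:ℝ) ^ (-(J:ℝ) * a) := by
  have hs0 : 0 < s := by omega
  have hsr : (0:ℝ) < s := by exact_mod_cast hs0
  have hb0 : 0 ≤ a / s := by positivity
  have hb1 : a / s ≤ 1 := by rw [div_le_one hsr]; linarith
  have hfd := finDim_polyDom l s
  set D := Module.finrank ℝ (PolyDom l s) with hD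
  set C₀ : ℝ := M * l ^ s * ((2 * T) ^ s * (T / 2) ^ (-γ)) with hC₀
  have hlr : (0:ℝ) < l := by exact_mod_cast (by omega : 0 < l)
  have hC₀pos : 0 < C₀ := by positivity
  refine ⟨l * 4 ^ l * (D + 1), 4 * C₀, by positivity, by positivity, fun J n hn => ?_⟩
  set e := C₀ * (2:ℝ) ^ (-(J:ℝ) * a) with he
  have hepos : 0 < e := by positivity
  have hmesh : ∀ j, 0 < hU T (a / s) J j := by
    intro j
    have : (0:ℝ) < mU (a / s) J j := by exact_mod_cast mU_pos _ _ _
    unfold hU; positivity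
  obtain ⟨L, hL1, hL2, hL3⟩ := cover_approx X (ι := NetIdx l (a / s) J)
    (fun ι => {t | ‖(fun i => (t i : ℝ)) - cU T (a / s) J ι‖ < 2 * hU T (a / s) J ι.1})
    (fun ι => by
      apply isOpen_lt _ continuous_const
      fun_prop)
    (fun t => net_cover hl hT hb1 J (t := fun i => (t i : ℝ)) (fun i _ => (t i).2))
    (fun ι => LinearMap.range (polyMap s T (cU T (a / s) J ι))) D
    (fun ι => LinearMap.finrank_range_le _) e hepos.le
    (by
      intro g hg' ι
      rw [hX] at hg'
      obtain ⟨f, hf, hgf⟩ := hg'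
      refine ⟨polyMap s T (cU T (a / s) J ι) (fun k => iteratedFDeriv ℝ k f (cU T (a / s) J ι)),
        LinearMap.mem_range_self _ _, fun t ht => ?_⟩
      obtain ⟨n', rfl⟩ : ∃ n', s = n' + 1 := ⟨s - 1, by omega⟩
      rw [hgf]
      exact ball_approx hl hT hM hrs hr ha1 hγ ha hg _ rfl J f hf ι t ht)
  have hLn : Module.finrank ℝ L ≤ n := by
    have hc := netIdx_card hl hb0 J
    have : (Fintype.card (NetIdx l (a / s) J) * D : ℝ) ≤ n := by
      refine le_trans ?_ hn
      have hS : 0 ≤ l * 4 ^ l * SJ (l - 1) (a / s * l) J := by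
        unfold SJ
        positivity
      calc (Fintype.card (NetIdx l (a / s) J) * D : ℝ) ≤ (l * 4 ^ l * SJ (l - 1) (a / s * l) J) * (D + 1) := by
            gcongr
            linarith
        _ = _ := by ring
    exact hL2.trans (by exact_mod_cast this)
  constructor
  · have := kolm_upper X L hLn e hepos.le hL3
    refine this.trans ?_
    rw [mul_assoc]; linarith
  · have := babenko_upper X L hLn e hepos hL3
    refine this.trans (le_of_eq ?_)
    rw [mul_assoc]
end WQ

namespace WQ

lemma exists_bump (l s : ℕ) : ∃ (φ : (Fin l → ℝ) → ℝ) (B : ℝ), (∀ n : ℕ, ContDiff ℝ n φ) ∧ φ 0 = 1 ∧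
    (∀ x, 1 / 3 < ‖x‖ → φ x = 0) ∧
    (∀ k x, 1 / 3 < ‖x‖ → iteratedFDeriv ℝ k φ x = 0) ∧ 0 < B ∧
    ∀ k ≤ s, ∀ x, ‖iteratedFDeriv ℝ k φ x‖ ≤ B := by
  let φ : ContDiffBump (0 : Fin l → ℝ) := ⟨1/6, 1/3, by norm_num, by norm_num⟩
  have hts : tsupport φ = closedBall 0 (1/3) := φ.tsupport_eq
  have hc : ∀ n : ℕ, ContDiff ℝ n φ := fun n => φ.contDiff
  have hout : ∀ x, 1 / 3 < ‖x‖ → x ∉ tsupport φ := by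
    intro x hx h
    rw [hts, mem_closedBall_zero_iff] at h
    linarith
  have hb : ∀ k : ℕ, ∃ C, ∀ x, ‖iteratedFDeriv ℝ k φ x‖ ≤ C := fun k =>
    (φ.hasCompactSupport.iteratedFDeriv (𝕜 := ℝ) k).exists_bound_of_continuous
      ((hc k).continuous_iteratedFDeriv le_rfl)
  choose C hC using hb
  refine ⟨φ, 1 + ∑ k ∈ Finset.range (s + 1), |C k|, hc, ?_, ?_, ?_, by positivity, ?_⟩
  · apply φ.one_of_mem_closedBall
    simp [φ.rIn_pos.le]
  · intro x hx
    exact image_eq_zero_of_notMem_tsupport (hout x hx)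
  · intro k x hx
    by_contra h
    exact hout x hx (support_iteratedFDeriv_subset k h)
  · intro k hk x
    refine (hC k x).trans ((le_abs_self _).trans ?_)
    have := Finset.single_le_sum (f := fun k => |C k|) (s := Finset.range (s + 1)) (fun i _ => abs_nonneg _)
      (Finset.mem_range.2 (Nat.lt_succ_of_le hk))
    linarith

section fam
variable {l : ℕ} {ι : Type} [Fintype ι]

/-- a sum of scaled bumps -/
noncomputable def bumpSum (φ : (Fin l → ℝ) → ℝ) (w : ℝ) (c : ι → Fin l → ℝ) (h : ι → ℝ) (a : ι → ℝ)
    (x : Fin l → ℝ) : ℝ := ∑ i, (a i * w) • φ ((h i)⁻¹ • (x - c i))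

lemma bump_piece_contDiff {φ : (Fin l → ℝ) → ℝ} (hφ : ∀ n : ℕ, ContDiff ℝ n φ) (n : ℕ) (b h : ℝ) (c : Fin l → ℝ) :
    ContDiff ℝ n (fun x => b • φ (h⁻¹ • (x - c))) := by
  have := hφ n
  fun_prop

lemma bump_piece_deriv {φ : (Fin l → ℝ) → ℝ} (hφ : ∀ n : ℕ, ContDiff ℝ n φ) (k : ℕ) (b h : ℝ) (c x : Fin l → ℝ) :
    iteratedFDeriv ℝ k (fun x => b • φ (h⁻¹ • (x - c))) x =
      b • (h⁻¹ ^ k • iteratedFDeriv ℝ k φ (h⁻¹ • (x - c))) := by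
  have h1 : ContDiff ℝ k (fun x => φ (h⁻¹ • (x - c))) := by have := hφ k; fun_prop
  rw [iteratedFDeriv_const_smul_apply' h1.contDiffAt]
  congr 1
  have := iteratedFDeriv_comp_sub (𝕜 := ℝ) (f := fun z => φ (h⁻¹ • z)) k c
  rw [show (fun x => φ (h⁻¹ • (x - c))) = fun z => (fun z => φ (h⁻¹ • z)) (z - c) from rfl]
  rw [this]
  rw [iteratedFDeriv_comp_const_smul _ (hφ k)]

lemma cube_uniqueDiff (l : ℕ) {T : ℝ} (hT : 0 < T) : UniqueDiffOn ℝ (cube l T) :=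
  UniqueDiffOn.univ_pi fun _ => uniqueDiffOn_Icc hT

lemma bumpSum_center {φ : (Fin l → ℝ) → ℝ} (hφ0 : φ 0 = 1) (hφout : ∀ x, 1 / 3 < ‖x‖ → φ x = 0)
    (w : ℝ) (c : ι → Fin l → ℝ) (h : ι → ℝ) (hh : ∀ i, 0 < h i)
    (hdisj : ∀ i i', i ≠ i' → h i / 3 + h i' / 3 < ‖c i - c i'‖) (a : ι → ℝ) (i : ι) :
    bumpSum φ w c h a (c i) = w * a i := by
  unfold bumpSum
  rw [Finset.sum_eq_single i]
  · simp [hφ0, mul_comm]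
  · intro i' _ hne
    rw [hφout, smul_zero]
    rw [norm_smul, norm_inv, Real.norm_of_nonneg (hh i').le, inv_mul_eq_div, lt_div_iff₀ (hh i')]
    have := hdisj i i' hne.symm
    have := hh i
    linarith
  · simp

lemma bumpSum_deriv_bound {φ : (Fin l → ℝ) → ℝ} (hφ : ∀ n : ℕ, ContDiff ℝ n φ) {B : ℝ} {k : ℕ}
    (hφout : ∀ x, 1 / 3 < ‖x‖ → iteratedFDeriv ℝ k φ x = 0)
    (hB : ∀ x, ‖iteratedFDeriv ℝ k φ x‖ ≤ B)
    {w : ℝ} (hw : 0 ≤ w) (c : ι → Fin l → ℝ) (h : ι → ℝ) (hh : ∀ i, 0 < h i)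
    (hdisj : ∀ i i', i ≠ i' → h i / 3 + h i' / 3 < ‖c i - c i'‖) (a : ι → ℝ) (ha : ∀ i, |a i| ≤ 1)
    (x : Fin l → ℝ) {Q : ℝ} (hQ : 0 ≤ Q) (hQi : ∀ i, ‖x - c i‖ ≤ h i / 3 → w * B ≤ Q * h i ^ k) (m : Fin k → Fin l) :
    |iteratedFDeriv ℝ k (bumpSum φ w c h a) x (fun j => Pi.single (m j) 1)| ≤ Q := by
  have hBnn : 0 ≤ B := (norm_nonneg _).trans (hB 0)
  have hD : iteratedFDeriv ℝ k (bumpSum φ w c h a) x =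
      ∑ i, (a i * w) • ((h i)⁻¹ ^ k • iteratedFDeriv ℝ k φ ((h i)⁻¹ • (x - c i))) := by
    unfold bumpSum
    rw [iteratedFDeriv_fun_sum_apply (fun i _ => (bump_piece_contDiff hφ k _ _ _).contDiffAt)]
    exact Finset.sum_congr rfl fun i _ => bump_piece_deriv hφ k _ _ _ _
  have hz : ∀ i, h i / 3 < ‖x - c i‖ → iteratedFDeriv ℝ k φ ((h i)⁻¹ • (x - c i)) = 0 := by
    intro i hi
    apply hφout
    rw [norm_smul, norm_inv, Real.norm_of_nonneg (hh i).le, inv_mul_eq_div, lt_div_iff₀ (hh i)]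
    linarith
  have hnorm : ‖iteratedFDeriv ℝ k (bumpSum φ w c h a) x‖ ≤ Q := by
    by_cases hx : ∃ i, ‖x - c i‖ ≤ h i / 3
    · obtain ⟨i, hi⟩ := hx
      rw [hD, Finset.sum_eq_single i]
      · rw [norm_smul, norm_smul, norm_mul, norm_pow, norm_inv, Real.norm_of_nonneg (hh i).le,
          Real.norm_of_nonneg hw, Real.norm_eq_abs]
        calc |a i| * w * ((h i)⁻¹ ^ k * ‖iteratedFDeriv ℝ k φ ((h i)⁻¹ • (x - c i))‖)
            ≤ 1 * w * ((h i)⁻¹ ^ k * B) := by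
              have := (hh i).le
              gcongr
              · exact ha i
              · exact hB _
          _ = (w * B) / h i ^ k := by rw [inv_pow]; field_simp
          _ ≤ Q := by
              rw [div_le_iff₀ (pow_pos (hh i) k)]
              exact hQi i hi
      · intro i' _ hne
        rw [hz i', smul_zero, smul_zero]
        have h1 := hdisj i i' hne.symm
        have h2 : ‖c i - c i'‖ ≤ ‖x - c i‖ + ‖x - c i'‖ := by
          have : c i - c i' = (x - c i') - (x - c i) := by abel
          rw [this]
          linarith [norm_sub_le (x - c i') (x - c i)]
        linarith
      · simp
    · push Not at hx
      rw [hD, Finset.sum_eq_zero (fun i _ => by rw [hz i (hx i), smul_zero, smul_zero]), norm_zero]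
      exact hQ
  rw [← Real.norm_eq_abs]
  refine (ContinuousMultilinearMap.le_opNorm _ _).trans ?_
  refine (mul_le_of_le_one_right (norm_nonneg _) ?_).trans hnorm
  apply Finset.prod_le_one (fun _ _ => norm_nonneg _)
  intro j _
  rw [pi_norm_le_iff_of_nonneg zero_le_one]
  intro i
  by_cases hi : i = m j
  · subst hi; simp
  · simp [hi]

lemma bumpSum_mem (hl : 2 ≤ l) {T M ζ : ℝ} {r s : ℕ} (hT : 0 < T) (hM : 0 < M) (hζ : ζ < 1)
    {φ : (Fin l → ℝ) → ℝ} (hφ : ∀ n : ℕ, ContDiff ℝ n φ) {B : ℝ} (hrs : r < s)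
    (hφout : ∀ k x, 1 / 3 < ‖x‖ → iteratedFDeriv ℝ k φ x = 0)
    (hB : ∀ k ≤ s, ∀ x, ‖iteratedFDeriv ℝ k φ x‖ ≤ B)
    {w : ℝ} (hw : 0 ≤ w) (c : ι → Fin l → ℝ) (h : ι → ℝ) (hh : ∀ i, 0 < h i)
    (hdisj : ∀ i i', i ≠ i' → h i / 3 + h i' / 3 < ‖c i - c i'‖)
    (i0 : Fin l) (τ : ι → ℝ) (hc0 : ∀ i, h i / 3 ≤ c i i0) (hτ : ∀ i, c i i0 + h i / 3 ≤ τ i)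
    (hA : ∀ i, ∀ k ≤ r, w * B ≤ M * h i ^ k)
    (hA' : ∀ i, ∀ k, r < k → k ≤ s → w * B ≤ M * τ i ^ (-((k:ℝ) - r - ζ)) * h i ^ k)
    (a : ι → ℝ) (ha : ∀ i, |a i| ≤ 1) :
    MemQStarMulti l T M r s ζ (bumpSum φ w c h a) := by
  have hcd : ∀ n : ℕ, ContDiff ℝ n (bumpSum φ w c h a) := by
    intro n
    unfold bumpSum
    exact ContDiff.sum fun i _ => bump_piece_contDiff hφ n _ _ _
  refine ⟨(hcd r).contDiffOn, (hcd s).contDiffOn, ?_, ?_⟩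
  · intro k hk m t ht
    rw [iteratedFDerivWithin_eq_iteratedFDeriv (cube_uniqueDiff l hT) (hcd k).contDiffAt ht]
    exact bumpSum_deriv_bound hφ (hφout k) (hB k (by omega)) hw c h hh hdisj a ha t hM.le (fun i _ => hA i k hk) m
  · intro k hk hks m t ht
    rw [iteratedFDerivWithin_eq_iteratedFDeriv (pcube_uniqueDiff hl T) (hcd k).contDiffAt ht]
    have hρ : 0 < rho t := ht.2
    refine bumpSum_deriv_bound hφ (hφout k) (hB k hks) hw c h hh hdisj a ha t (by positivity) (fun i hi => ?_) m
    refine (hA' i k hk hks).trans ?_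
    have h1 : rho t ≤ τ i := by
      refine (rho_le t i0).trans ?_
      have h2 := (norm_le_pi_norm (t - c i) i0).trans hi
      rw [Pi.sub_apply, Real.norm_eq_abs, abs_le] at h2
      have h3 := hc0 i
      have h4 := hτ i
      rw [abs_le]; constructor <;> linarith [hh i]
    have hk' : (r:ℝ) + 1 ≤ k := by exact_mod_cast hk
    have h5 : τ i ^ (-((k:ℝ) - r - ζ)) ≤ rho t ^ (-((k:ℝ) - r - ζ)) :=
      Real.rpow_le_rpow_of_nonpos hρ h1 (by linarith)
    have := (hh i).le
    gcongr

lemma X_bounded {T M ζ : ℝ} {r s : ℕ} 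
    (X : Set C(Fin l → Set.Icc (0:ℝ) T, ℝ)) (hM : 0 < M)
    (hX : X = { g : C(Fin l → Set.Icc (0:ℝ) T, ℝ) |
      ∃ f : (Fin l → ℝ) → ℝ, MemQStarMulti l T M r s ζ f ∧
        ∀ t : Fin l → Set.Icc (0:ℝ) T, g t = f fun i => (t i : ℝ) }) : Bornology.IsBounded X := by
  rw [isBounded_iff_forall_norm_le]
  refine ⟨M, fun g hg => ?_⟩
  rw [hX] at hg
  obtain ⟨f, hf, hgf⟩ := hg
  rw [ContinuousMap.norm_le _ hM.le]
  intro t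
  have := hf.2.2.1 0 (Nat.zero_le _) Fin.elim0 (fun i => (t i : ℝ)) (fun i _ => (t i).2)
  rw [iteratedFDerivWithin_zero_apply] at this
  rw [hgf]; exact this

lemma bump_widths {T M ζ : ℝ} {r s : ℕ} (hM : 0 < M)
    (X : Set C(Fin l → Set.Icc (0:ℝ) T, ℝ))
    (hX : X = { g : C(Fin l → Set.Icc (0:ℝ) T, ℝ) |
      ∃ f : (Fin l → ℝ) → ℝ, MemQStarMulti l T M r s ζ f ∧
        ∀ t : Fin l → Set.Icc (0:ℝ) T, g t = f fun i => (t i : ℝ) })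
    {φ : (Fin l → ℝ) → ℝ} (hφ : ∀ n : ℕ, ContDiff ℝ n φ) 
    {w : ℝ} (hw : 0 ≤ w) (c : ι → Fin l → ℝ) (h : ι → ℝ) (hc : ∀ i, c i ∈ cube l T)
    (hcen : ∀ a i, bumpSum φ w c h a (c i) = w * a i)
    (hmem : ∀ a : ι → ℝ, (∀ i, |a i| ≤ 1) → MemQStarMulti l T M r s ζ (bumpSum φ w c h a))
    (n : ℕ) (hn : n < Fintype.card ι) :
    w ≤ kolmogorovWidth n X ∧ w / 6 ≤ babenkoWidth n X := by
  classical
  have hbd := X_bounded X hM hX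
  let e := Fintype.equivFin ι
  let cc : ι → (Fin l → Set.Icc (0:ℝ) T) := fun i j => ⟨c i j, hc i j (mem_univ j)⟩
  have hcont : ∀ a, Continuous (bumpSum φ w c h a) := by
    intro a
    unfold bumpSum
    exact continuous_finsetSum _ fun i _ => (bump_piece_contDiff hφ 0 _ _ _).continuous
  let G : (ι → ℝ) → C(Fin l → Set.Icc (0:ℝ) T, ℝ) := fun a =>
    ⟨fun t => bumpSum φ w c h a (fun i => (t i : ℝ)), (hcont a).comp (by fun_prop)⟩
  have hGX : ∀ a : ι → ℝ, (∀ i, |a i| ≤ 1) → G a ∈ X := by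
    intro a ha
    rw [hX]
    exact ⟨bumpSum φ w c h a, hmem a ha, fun t => rfl⟩
  have hGc : ∀ a i, G a (cc i) = w * a i := fun a i => hcen a i
  have hreidx : ∀ a : Fin (Fintype.card ι) → ℝ, ‖a‖ ≤ 1 → ∀ i, |a (e i)| ≤ 1 :=
    fun a ha i => (norm_le_pi_norm a (e i)).trans ha
  constructor
  · apply kolm_lower X hn hbd (fun i => cc (e.symm i)) w
    intro a ha
    refine ⟨G (fun i => a (e i)), hGX _ (hreidx a ha), fun i => ?_⟩
    rw [hGc]; simp
  · apply babenko_lower X hn hbd (fun a => G (fun i => a (e i)))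
    · have hlin : ∀ a : ι → ℝ, G a = ∑ i, a i • G (Pi.single i 1) := by
        intro a
        ext t
        rw [ContinuousMap.sum_apply]
        simp only [G, bumpSum, ContinuousMap.coe_mk, ContinuousMap.smul_apply, smul_eq_mul]
        refine Finset.sum_congr rfl fun i _ => ?_
        rw [Finset.sum_eq_single i]
        · simp; ring
        · intro b _ hb; simp [hb]
        · simp
      have : (fun a : Fin (Fintype.card ι) → ℝ => G (fun i => a (e i))) =
          fun a => ∑ i, a (e i) • G (Pi.single i 1) := by
        funext a; exact hlin _
      rw [this]
      fun_prop
    · intro a ha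
      exact hGX _ (hreidx a ha)
    · exact hw
    · intro a b
      have : ‖w • (a - b)‖ ≤ ‖G (fun i => a (e i)) - G (fun i => b (e i))‖ := by
        rw [pi_norm_le_iff_of_nonneg (norm_nonneg _)]
        intro i
        have h1 := ContinuousMap.norm_coe_le_norm (G (fun i => a (e i)) - G (fun i => b (e i))) (cc (e.symm i))
        rw [ContinuousMap.sub_apply, hGc, hGc] at h1
        simpa [mul_sub] using h1
      rwa [norm_smul, Real.norm_of_nonneg hw] at this
end fam
end WQ

namespace WQ

/-- number of subdivisions in layer `j`, lower bound version -/
noncomputable def mL (β : ℝ) (J j : ℕ) : ℕ := ⌊(2:ℝ) ^ (((J:ℝ) - j) * β)⌋₊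

lemma mL_le (β : ℝ) (J j : ℕ) : (mL β J j : ℝ) ≤ (2:ℝ) ^ (((J:ℝ) - j) * β) :=
  Nat.floor_le (by positivity)

lemma one_le_pw {β : ℝ} (hβ : 0 ≤ β) {J j : ℕ} (hj : j ≤ J) : (1:ℝ) ≤ (2:ℝ) ^ (((J:ℝ) - j) * β) := by
  apply Real.one_le_rpow (by norm_num)
  have : (j:ℝ) ≤ J := by exact_mod_cast hj
  exact mul_nonneg (by linarith) hβ

lemma mL_pos {β : ℝ} (hβ : 0 ≤ β) {J j : ℕ} (hj : j ≤ J) : 0 < mL β J j :=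
  Nat.floor_pos.2 (one_le_pw hβ hj)

lemma mL_ge {β : ℝ} (hβ : 0 ≤ β) {J j : ℕ} (hj : j ≤ J) :
    (2:ℝ) ^ (((J:ℝ) - j) * β) ≤ 2 * (mL β J j : ℝ) := by
  have h1 : (1:ℝ) ≤ mL β J j := by exact_mod_cast mL_pos hβ hj
  have := Nat.lt_floor_add_one ((2:ℝ) ^ (((J:ℝ) - j) * β))
  unfold mL at *
  linarith

/-- index type of the bumps -/
abbrev BIdx (l : ℕ) (i0 : Fin l) (β : ℝ) (J : ℕ) : Type :=
  Σ j : Fin (J + 1), ∀ i : Fin l, Fin (if i = i0 then mL β J j else 2 ^ (j:ℕ) * mL β J j)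

lemma bIdx_card {l : ℕ} (hl : 2 ≤ l) (i0 : Fin l) {β : ℝ} (hβ : 0 ≤ β) (J : ℕ) :
    SJ (l - 1) (β * l) J ≤ 2 ^ l * (Fintype.card (BIdx l i0 β J) : ℝ) := by
  have hl' : ((l - 1 : ℕ) : ℝ) = (l:ℝ) - 1 := by rw [Nat.cast_sub (by omega)]; simp
  have h1 : ∀ j : Fin (J + 1),
      Fintype.card (∀ i : Fin l, Fin (if i = i0 then mL β J j else 2 ^ (j:ℕ) * mL β J j))
      = (mL β J j) * (2 ^ (j:ℕ) * mL β J j) ^ (l - 1) := by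
    intro j
    rw [Fintype.card_pi]
    simp only [Fintype.card_fin]
    rw [← Finset.mul_prod_erase _ _ (Finset.mem_univ i0), if_pos rfl]
    congr 1
    rw [Finset.prod_congr rfl (g := fun _ => 2 ^ (j:ℕ) * mL β J j)]
    · rw [Finset.prod_const, Finset.card_erase_of_mem (Finset.mem_univ _)]; simp
    · intro i hi
      rw [if_neg (Finset.ne_of_mem_erase hi)]
  rw [Fintype.card_sigma]
  simp only [h1]
  rw [Fin.sum_univ_eq_sum_range (fun j => ((mL β J j) * (2 ^ (j:ℕ) * mL β J j) ^ (l - 1))) (J + 1)]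
  unfold SJ
  push_cast
  rw [Finset.mul_sum]
  refine Finset.sum_le_sum fun j hj => ?_
  have hj' : j ≤ J := by simpa [Nat.lt_succ_iff] using hj
  set m : ℝ := ((mL β J j : ℕ) : ℝ) with hm
  set y : ℝ := (2:ℝ) ^ (((J:ℝ) - j) * β) with hy
  have hmy : y ≤ 2 * m := mL_ge hβ hj'
  have hypos : 0 < y := by positivity
  calc (2:ℝ) ^ ((j:ℝ) * ((l:ℝ) - 1) + ((J:ℝ) - j) * (β * l)) = y ^ l * (2 ^ j) ^ (l - 1) := by
        rw [Real.rpow_add (by norm_num), mul_comm]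
        congr 1
        · rw [hy, ← Real.rpow_natCast, ← Real.rpow_mul (by norm_num)]
          congr 1; ring
        · rw [← hl', Real.rpow_mul (by norm_num), Real.rpow_natCast, Real.rpow_natCast]
    _ ≤ (2 * m) ^ l * (2 ^ j) ^ (l - 1) := by gcongr
    _ = 2 ^ l * (m * (2 ^ j * m) ^ (l - 1)) := by
        obtain ⟨k, rfl⟩ : ∃ k, l = k + 1 := ⟨l - 1, by omega⟩
        simp only [Nat.add_sub_cancel, mul_pow, pow_succ]; ring

/-- mesh -/
noncomputable def hL (T β : ℝ) (J j : ℕ) : ℝ := T / 2 ^ (j + 2) / mL β J j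

/-- bump centers -/
noncomputable def cL {l : ℕ} {i0 : Fin l} (T β : ℝ) (J : ℕ) (ι : BIdx l i0 β J) : Fin l → ℝ := fun i =>
  (if i = i0 then T / 2 ^ ((ι.1:ℕ) + 2) else T / 2) + hL T β J ι.1 * ((ι.2 i : ℕ) + 1 / 2)

section
variable {l : ℕ} {i0 : Fin l} {T β : ℝ} (hT : 0 < T) (hβ : 0 ≤ β) {J : ℕ}

lemma hL_pos' (hT : 0 < T) (hβ : 0 ≤ β) {j : ℕ} (hj : j ≤ J) : 0 < hL T β J j := by
  have : (0:ℝ) < mL β J j := by exact_mod_cast mL_pos hβ hj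
  unfold hL; positivity

lemma hL_mul (hβ : 0 ≤ β) {j : ℕ} (hj : j ≤ J) : hL T β J j * mL β J j = T / 2 ^ (j + 2) := by
  have : (0:ℝ) < mL β J j := by exact_mod_cast mL_pos hβ hj
  unfold hL; field_simp

lemma cL_zero_bounds (hT : 0 < T) (hβ : 0 ≤ β) (ι : BIdx l i0 β J) :
    T / 2 ^ ((ι.1:ℕ) + 2) + hL T β J ι.1 / 2 ≤ cL T β J ι i0 ∧
      cL T β J ι i0 + hL T β J ι.1 / 2 ≤ T / 2 ^ ((ι.1:ℕ) + 1) := by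
  have hj : (ι.1 : ℕ) ≤ J := by omega
  have hp := hL_pos' hT hβ hj
  have hk : (ι.2 i0 : ℕ) < mL β J ι.1 := by
    exact (ι.2 i0).2.trans_eq (if_pos rfl)
  have hk' : ((ι.2 i0 : ℕ) : ℝ) + 1 ≤ mL β J ι.1 := by exact_mod_cast hk
  have hm := hL_mul (T := T) hβ hj
  have h2 : T / 2 ^ ((ι.1:ℕ) + 1) = T / 2 ^ ((ι.1:ℕ) + 2) + T / 2 ^ ((ι.1:ℕ) + 2) := by
    rw [pow_succ _ ((ι.1:ℕ) + 1)]; field_simp; ring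
  unfold cL
  rw [if_pos rfl]
  have h0 : (0:ℝ) ≤ ((ι.2 i0 : ℕ) : ℝ) := Nat.cast_nonneg _
  constructor
  · nlinarith
  · rw [h2]
    nlinarith

lemma cL_bounds (hT : 0 < T) (hβ : 0 ≤ β) (ι : BIdx l i0 β J) : cL T β J ι ∈ cube l T := by
  have hj : (ι.1 : ℕ) ≤ J := by omega
  have hp := hL_pos' hT hβ hj
  intro i _
  by_cases hi : i = i0
  · subst hi
    have h1 := cL_zero_bounds hT hβ ι
    have h2 : 0 < T / 2 ^ ((ι.1:ℕ) + 2) := by positivity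
    have h3 : T / 2 ^ ((ι.1:ℕ) + 1) ≤ T := div_le_self hT.le (one_le_pow₀ (by norm_num))
    constructor <;> linarith
  · have hk : (ι.2 i : ℕ) < 2 ^ (ι.1:ℕ) * mL β J ι.1 := by
      exact (ι.2 i).2.trans_eq (if_neg hi)
    have hk' : ((ι.2 i : ℕ) : ℝ) + 1 ≤ 2 ^ (ι.1:ℕ) * mL β J ι.1 := by exact_mod_cast hk
    have hm := hL_mul (T := T) hβ hj
    have h2 : hL T β J ι.1 * (2 ^ (ι.1:ℕ) * mL β J ι.1) = T / 4 := by
      rw [mul_left_comm, hm, pow_add]; field_simp; norm_num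
    have h0 : (0:ℝ) ≤ ((ι.2 i : ℕ) : ℝ) := Nat.cast_nonneg _
    have h3 := mul_le_mul_of_nonneg_left hk' hp.le
    unfold cL
    rw [if_neg hi]
    constructor
    · positivity
    · nlinarith

lemma cL_disj_lt (hT : 0 < T) (hβ : 0 ≤ β) (ι κ : BIdx l i0 β J) (hne : (ι.1:ℕ) < κ.1) :
    hL T β J ι.1 / 3 + hL T β J κ.1 / 3 < ‖cL T β J ι - cL T β J κ‖ := by
  have hp := hL_pos' (J := J) hT hβ (j := ι.1) (by omega)
  have hp' := hL_pos' (J := J) hT hβ (j := κ.1) (by omega)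
  have h1 := (cL_zero_bounds hT hβ ι).1
  have h2 := (cL_zero_bounds hT hβ κ).2
  have h3 : T / 2 ^ ((κ.1:ℕ) + 1) ≤ T / 2 ^ ((ι.1:ℕ) + 2) := by
    apply div_le_div_of_nonneg_left hT.le (by positivity)
    exact pow_le_pow_right₀ (by norm_num) (by omega)
  have h4 := norm_le_pi_norm (cL T β J ι - cL T β J κ) i0
  rw [Pi.sub_apply, Real.norm_eq_abs] at h4
  have := le_abs_self (cL T β J ι i0 - cL T β J κ i0)
  linarith

lemma cL_disj (hT : 0 < T) (hβ : 0 ≤ β) (ι κ : BIdx l i0 β J) (hne : ι ≠ κ) :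
    hL T β J ι.1 / 3 + hL T β J κ.1 / 3 < ‖cL T β J ι - cL T β J κ‖ := by
  rcases lt_trichotomy (ι.1:ℕ) κ.1 with h | h | h
  · exact cL_disj_lt hT hβ ι κ h
  · obtain ⟨j, k⟩ := ι
    obtain ⟨j', k'⟩ := κ
    have : j = j' := Fin.ext h
    subst this
    have hkk : k ≠ k' := fun h => hne (by rw [h])
    obtain ⟨i, hi⟩ := Function.ne_iff.1 hkk
    have hp := hL_pos' (J := J) hT hβ (j := j) (by omega)
    have h4 := norm_le_pi_norm (cL T β J ⟨j, k⟩ - cL T β J ⟨j, k'⟩) i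
    rw [Pi.sub_apply, Real.norm_eq_abs] at h4
    have h5 : cL T β J ⟨j, k⟩ i - cL T β J ⟨j, k'⟩ i = hL T β J j * (((k i : ℕ) : ℝ) - (k' i : ℕ)) := by
      unfold cL; ring
    have h6 : (1:ℝ) ≤ |((k i : ℕ) : ℝ) - (k' i : ℕ)| := by
      have h7 : (k i : ℕ) ≠ (k' i : ℕ) := fun h => hi (Fin.ext h)
      have h8 : (1:ℤ) ≤ |((k i : ℕ) : ℤ) - (k' i : ℕ)| := by
        apply Int.one_le_abs
        omega
      exact_mod_cast h8
    rw [h5, abs_mul, abs_of_pos hp] at h4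
    simp only
    nlinarith
  · rw [norm_sub_rev, add_comm]
    exact cL_disj_lt hT hβ κ ι h
end

lemma exists_min_pos (g : ℕ → ℝ) (hg : ∀ k, 0 < g k) (N : ℕ) : ∃ κ > 0, ∀ k ≤ N, κ ≤ g k := by
  induction N with
  | zero => exact ⟨g 0, hg 0, fun k hk => by rw [Nat.le_zero.1 hk]⟩
  | succ N ih =>
    obtain ⟨κ, h0, h1⟩ := ih
    refine ⟨min κ (g (N + 1)), lt_min h0 (hg _), fun k hk => ?_⟩
    rcases Nat.le_succ_iff.1 hk with h | h
    · exact (min_le_left _ _).trans (h1 k h)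
    · rw [h]; exact min_le_right _ _

lemma hL_ge {T β : ℝ} (hT : 0 < T) (hβ : 0 ≤ β) {J j : ℕ} (hj : j ≤ J) :
    T / 4 * (2:ℝ) ^ (-(j:ℝ) - ((J:ℝ) - j) * β) ≤ hL T β J j := by
  have h1 := mL_le β J j
  have h2 : (0:ℝ) < mL β J j := by exact_mod_cast mL_pos hβ hj
  unfold hL
  rw [Real.rpow_sub (by norm_num), Real.rpow_neg (by norm_num), Real.rpow_natCast]
  calc T / 4 * ((2 ^ j)⁻¹ / (2:ℝ) ^ (((J:ℝ) - j) * β)) = T / 2 ^ (j + 2) / (2:ℝ) ^ (((J:ℝ) - j) * β) := by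
        rw [pow_add]; field_simp; norm_num
    _ ≤ _ := by gcongr

lemma lower_main {l : ℕ} (hl : 2 ≤ l) {T M ζ γ a : ℝ} {r s : ℕ} (hT : 0 < T) (hM : 0 < M) (hrs : r < s)
    (hζ1 : ζ < 1) (hζ0 : 0 ≤ ζ) (ha1 : 1 ≤ a) (hγ : 0 < γ) (ha : (s:ℝ) - γ = a)
    (hg : (s : ℝ) - r - ζ = γ)
    (X : Set C(Fin l → Set.Icc (0:ℝ) T, ℝ))
    (hX : X = { g : C(Fin l → Set.Icc (0:ℝ) T, ℝ) |
      ∃ f : (Fin l → ℝ) → ℝ, MemQStarMulti l T M r s ζ f ∧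
        ∀ t : Fin l → Set.Icc (0:ℝ) T, g t = f fun i => (t i : ℝ) }) :
    ∃ A C : ℝ, 0 < A ∧ 0 < C ∧ ∀ J n : ℕ, A * n < SJ (l - 1) (a / s * l) J →
      C * (2:ℝ) ^ (-(J:ℝ) * a) ≤ kolmogorovWidth n X ∧ C * (2:ℝ) ^ (-(J:ℝ) * a) ≤ babenkoWidth n X := by
  have hsr : (0:ℝ) < s := by exact_mod_cast (by omega : 0 < s)
  have hb0 : 0 ≤ a / s := by positivity
  obtain ⟨φ, B, hφ, hφ0, hφout, hφout', hB0, hB⟩ := exists_bump l s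
  obtain ⟨κ₁, hκ1, hκ1'⟩ := exists_min_pos (fun k => (T / 4) ^ k) (fun k => by positivity) s
  obtain ⟨κ₂, hκ2, hκ2'⟩ := exists_min_pos (fun k => (T / 2) ^ (-((k:ℝ) - r - ζ)) * (T / 4) ^ k)
    (fun k => by positivity) s
  set κ := min κ₁ κ₂ with hκ
  have hκ0 : 0 < κ := lt_min hκ1 hκ2
  set C₀ := M * κ / B with hC₀
  have hC0 : 0 < C₀ := by positivity
  let i0 : Fin l := ⟨0, by omega⟩
  refine ⟨2 ^ l, C₀ / 6, by positivity, by positivity, fun J n hn => ?_⟩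
  set w := C₀ * (2:ℝ) ^ (-(J:ℝ) * a) with hw
  have hw0 : 0 < w := by positivity
  have hwB : w * B = M * κ * (2:ℝ) ^ (-(J:ℝ) * a) := by
    rw [hw, hC₀]; field_simp
  have hcard : n < Fintype.card (BIdx l i0 (a / s) J) := by
    have h1 := hn.trans_le (bIdx_card hl i0 hb0 J)
    have h2 := lt_of_mul_lt_mul_left h1 (by positivity)
    exact_mod_cast h2
  have hdisj := fun ι κ => cL_disj (l := l) (i0 := i0) (J := J) hT hb0 ι κ
  have hpos : ∀ ι : BIdx l i0 (a / s) J, 0 < hL T (a / s) J ι.1 :=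
    fun ι => hL_pos' hT hb0 (by omega)
  have hpw : ∀ ι : BIdx l i0 (a / s) J, ∀ k : ℕ, (T / 4) ^ k * (2:ℝ) ^ (-((ι.1:ℕ):ℝ) * k - ((J:ℝ) - (ι.1:ℕ)) * (a / s) * k)
      ≤ hL T (a / s) J ι.1 ^ k := by
    intro ι k
    have h1 := hL_ge hT hb0 (J := J) (j := ι.1) (by omega)
    have h2 := pow_le_pow_left₀ (by positivity) h1 k
    refine le_trans (le_of_eq ?_) h2
    rw [mul_pow, ← Real.rpow_natCast ((2:ℝ) ^ _), ← Real.rpow_mul (by norm_num)]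
    congr 2; ring
  have hks : ∀ k : ℕ, k ≤ s → a / s * k ≤ a := by
    intro k hk
    have : (k:ℝ) ≤ s := by exact_mod_cast hk
    rw [div_mul_eq_mul_div, div_le_iff₀ hsr]
    nlinarith
  have hjJ : ∀ ι : BIdx l i0 (a / s) J, (((ι.1:ℕ):ℝ)) ≤ J := by
    intro ι
    have : (ι.1:ℕ) ≤ J := by omega
    exact_mod_cast this
  have key := bump_widths hM X hX hφ hw0.le (cL (i0 := i0) T (a / s) J) (fun ι => hL T (a / s) J ι.1)
    (fun ι => cL_bounds hT hb0 ι)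
    (fun b ι => bumpSum_center hφ0 hφout w _ _ hpos hdisj b ι)
    (fun b hb => bumpSum_mem hl hT hM hζ1 hφ hrs hφout' hB hw0.le _ _ hpos hdisj i0
      (fun ι => T / 2 ^ ((ι.1:ℕ) + 1))
      (fun ι => by
        have h1 := (cL_zero_bounds hT hb0 ι).1
        have h2 := hpos ι
        have h3 : 0 < T / 2 ^ ((ι.1:ℕ) + 2) := by positivity
        linarith)
      (fun ι => by
        have h1 := (cL_zero_bounds hT hb0 ι).2
        have h2 := hpos ι
        linarith)
      (fun ι k hk => by
        rw [hwB, mul_assoc]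
        refine mul_le_mul_of_nonneg_left ?_ hM.le
        refine le_trans ?_ (hpw ι k)
        have h1 : κ ≤ (T / 4) ^ k := (min_le_left _ _).trans (hκ1' k (by omega))
        refine mul_le_mul h1 ?_ (by positivity) (by positivity)
        apply Real.rpow_le_rpow_of_exponent_le (by norm_num)
        have h2 := hks k (by omega)
        have h3 := hjJ ι
        have h4 : (k:ℝ) ≤ a := by
          have : (k:ℝ) ≤ r := by exact_mod_cast hk
          linarith
        have h5 : ((J:ℝ) - (ι.1:ℕ)) * (a / s) * k ≤ ((J:ℝ) - (ι.1:ℕ)) * a := by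
          rw [mul_assoc]; exact mul_le_mul_of_nonneg_left h2 (by linarith)
        have h6 : ((ι.1:ℕ):ℝ) * k ≤ ((ι.1:ℕ):ℝ) * a := mul_le_mul_of_nonneg_left h4 (Nat.cast_nonneg _)
        linarith)
      (fun ι k hk hk' => by
        rw [hwB, mul_assoc, mul_assoc]
        refine mul_le_mul_of_nonneg_left ?_ hM.le
        have h0 : (T / 2 ^ ((ι.1:ℕ) + 1)) ^ (-((k:ℝ) - r - ζ)) =
            (T / 2) ^ (-((k:ℝ) - r - ζ)) * (2:ℝ) ^ (((ι.1:ℕ):ℝ) * ((k:ℝ) - r - ζ)) := by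
          rw [show T / 2 ^ ((ι.1:ℕ) + 1) = (T / 2) * (2:ℝ) ^ (-((ι.1:ℕ):ℝ)) by
            rw [Real.rpow_neg (by norm_num), Real.rpow_natCast, pow_succ]; field_simp]
          rw [Real.mul_rpow (by positivity) (by positivity), ← Real.rpow_mul (by norm_num)]
          congr 2; ring
        rw [h0]
        refine le_trans ?_ (mul_le_mul_of_nonneg_left (hpw ι k) (by positivity))
        have h1 : κ ≤ (T / 2) ^ (-((k:ℝ) - r - ζ)) * (T / 4) ^ k := (min_le_right _ _).trans (hκ2' k (by omega))
        calc κ * (2:ℝ) ^ (-(J:ℝ) * a) ≤ ((T / 2) ^ (-((k:ℝ) - r - ζ)) * (T / 4) ^ k) *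
              ((2:ℝ) ^ (((ι.1:ℕ):ℝ) * ((k:ℝ) - r - ζ) + (-((ι.1:ℕ):ℝ) * k - ((J:ℝ) - (ι.1:ℕ)) * (a / s) * k))) := by
              refine mul_le_mul h1 ?_ (by positivity) (by positivity)
              apply Real.rpow_le_rpow_of_exponent_le (by norm_num)
              have h2 := hks k (by omega)
              have h3 := hjJ ι
              have h5 : ((J:ℝ) - (ι.1:ℕ)) * (a / s) * k ≤ ((J:ℝ) - (ι.1:ℕ)) * a := by
                rw [mul_assoc]; exact mul_le_mul_of_nonneg_left h2 (by linarith)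
              have h7 : (k:ℝ) - r - ζ = k - a := by linarith
              rw [h7]
              linarith
          _ = _ := by rw [Real.rpow_add (by norm_num)]; ring)
      b hb) n hcard
  refine ⟨le_trans ?_ key.1, le_trans (le_of_eq ?_) key.2⟩
  · rw [hw]
    rw [div_mul_eq_mul_div]
    linarith
  · rw [hw]; ring
end WQ

namespace WQ

lemma dyadic {θ y : ℝ} (hθ : 0 < θ) (hy : 1 ≤ y) :
    ∃ J : ℕ, (2:ℝ) ^ ((J:ℝ) * θ) ≤ y ∧ y < (2:ℝ) ^ (((J:ℝ) + 1) * θ) := by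
  have hy0 : 0 < y := by linarith
  have hlog : 0 ≤ Real.logb 2 y / θ := div_nonneg (Real.logb_nonneg (by norm_num) hy) hθ.le
  refine ⟨⌊Real.logb 2 y / θ⌋₊, ?_, ?_⟩
  · rw [← Real.le_logb_iff_rpow_le (by norm_num) hy0, ← le_div_iff₀ hθ]
    exact Nat.floor_le hlog
  · rw [← Real.logb_lt_iff_lt_rpow (by norm_num) hy0, ← div_lt_iff₀ hθ]
    exact Nat.lt_floor_add_one _

lemma pow_conv {θ a : ℝ} (hθ : 0 < θ) (x : ℝ) : ((2:ℝ) ^ (x * θ)) ^ (-a / θ) = (2:ℝ) ^ (-x * a) := by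
  rw [← Real.rpow_mul (by norm_num)]
  congr 1; field_simp

lemma lower_abs {θ a A C : ℝ} (hθ : 0 < θ) (ha : 0 < a) (hC : 0 < C) {S : ℕ → ℝ} {W : ℕ → ℝ}
    (hW : ∀ J n : ℕ, A * n < S J → C * (2:ℝ) ^ (-(J:ℝ) * a) ≤ W n) {n : ℕ} {y : ℝ} (hy : 1 ≤ y)
    (h : ∀ J : ℕ, (2:ℝ) ^ ((J:ℝ) * θ) ≤ y → y < (2:ℝ) ^ (((J:ℝ) + 1) * θ) → A * n < S (J + 1)) :
    C * (2:ℝ) ^ (-a) * y ^ (-a / θ) ≤ W n := by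
  obtain ⟨J, h1, h2⟩ := dyadic hθ hy
  refine le_trans ?_ (hW (J + 1) n (h J h1 h2))
  have h3 : y ^ (-a / θ) ≤ ((2:ℝ) ^ ((J:ℝ) * θ)) ^ (-a / θ) :=
    Real.rpow_le_rpow_of_nonpos (by positivity) h1 (by
      apply div_nonpos_of_nonpos_of_nonneg <;> linarith)
  rw [pow_conv hθ] at h3
  calc C * (2:ℝ) ^ (-a) * y ^ (-a / θ) ≤ C * (2:ℝ) ^ (-a) * (2:ℝ) ^ (-(J:ℝ) * a) := by gcongr
    _ = _ := by
      rw [mul_assoc, ← Real.rpow_add (by norm_num)]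
      congr 2; push_cast; ring

lemma upper_abs {θ a A C : ℝ} (hθ : 0 < θ) (ha : 0 < a) (hC : 0 < C) {S : ℕ → ℝ} {W : ℕ → ℝ}
    (hW : ∀ J n : ℕ, A * S J ≤ n → W n ≤ C * (2:ℝ) ^ (-(J:ℝ) * a)) {n : ℕ} {y : ℝ} (hy : 1 ≤ y)
    (h : ∀ J : ℕ, (2:ℝ) ^ ((J:ℝ) * θ) ≤ y → A * S J ≤ n) :
    W n ≤ C * (2:ℝ) ^ a * y ^ (-a / θ) := by
  obtain ⟨J, h1, h2⟩ := dyadic hθ hy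
  refine (hW J n (h J h1)).trans ?_
  have h3 : ((2:ℝ) ^ (((J:ℝ) + 1) * θ)) ^ (-a / θ) ≤ y ^ (-a / θ) :=
    Real.rpow_le_rpow_of_nonpos (by linarith) h2.le (by
      apply div_nonpos_of_nonpos_of_nonneg <;> linarith)
  rw [pow_conv hθ] at h3
  calc C * (2:ℝ) ^ (-(J:ℝ) * a) = C * (2:ℝ) ^ a * (2:ℝ) ^ (-((J:ℝ) + 1) * a) := by
        rw [mul_assoc, ← Real.rpow_add (by norm_num)]
        congr 2; ring
    _ ≤ _ := by gcongr

lemma asym_pow {θ a A₁ C₁ A₂ C₂ D : ℝ} (hθ : 0 < θ) (ha : 0 < a) (hC₁ : 0 < C₁) (hC₂ : 0 < C₂) (hA₁ : 0 < A₁)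
    (hA₂ : 0 < A₂) (hD : 0 < D)
    {S : ℕ → ℝ} {Wl Wu : ℕ → ℝ} (hS1 : ∀ J : ℕ, (2:ℝ) ^ ((J:ℝ) * θ) ≤ S J)
    (hS2 : ∀ J : ℕ, S J ≤ D * (2:ℝ) ^ ((J:ℝ) * θ))
    (hl : ∀ J n : ℕ, A₁ * n < S J → C₁ * (2:ℝ) ^ (-(J:ℝ) * a) ≤ Wl n)
    (hu : ∀ J n : ℕ, A₂ * S J ≤ n → Wu n ≤ C₂ * (2:ℝ) ^ (-(J:ℝ) * a)) :
    ∃ c₁ c₂ : ℝ, 0 < c₁ ∧ 0 < c₂ ∧ ∃ n₀ : ℕ, ∀ n : ℕ, n₀ ≤ n →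
      c₁ * (n:ℝ) ^ (-a / θ) ≤ Wl n ∧ Wu n ≤ c₂ * (n:ℝ) ^ (-a / θ) := by
  refine ⟨C₁ * (2:ℝ) ^ (-a) * A₁ ^ (-a / θ), C₂ * (2:ℝ) ^ a * (1 / (A₂ * D)) ^ (-a / θ), by positivity,
    by positivity, max ⌈1 / A₁⌉₊ ⌈A₂ * D⌉₊, fun n hn => ?_⟩
  have hn1 : 1 / A₁ ≤ n := (Nat.le_ceil _).trans (by exact_mod_cast (le_max_left _ _).trans hn)
  have hn2 : A₂ * D ≤ n := (Nat.le_ceil _).trans (by exact_mod_cast (le_max_right _ _).trans hn)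
  constructor
  · have := lower_abs hθ ha hC₁ hl (n := n) (y := A₁ * n) (by rw [div_le_iff₀ hA₁] at hn1; linarith)
      (fun J _ h2 => h2.trans_le (by have := hS1 (J + 1); push_cast at this; exact this))
    rw [Real.mul_rpow hA₁.le (Nat.cast_nonneg _)] at this
    rw [mul_assoc]
    exact this
  · have := upper_abs hθ ha hC₂ hu (n := n) (y := 1 / (A₂ * D) * n)
      (by rw [one_div, inv_mul_eq_div, le_div_iff₀ (by positivity)]; linarith)
      (fun J h1 => by
        calc A₂ * S J ≤ A₂ * (D * (2:ℝ) ^ ((J:ℝ) * θ)) := by gcongr; exact hS2 J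
          _ ≤ A₂ * (D * (1 / (A₂ * D) * n)) := by gcongr
          _ = n := by field_simp)
    rw [Real.mul_rpow (by positivity) (Nat.cast_nonneg _)] at this
    rw [mul_assoc]
    exact this

lemma asym_log {θ a A₁ C₁ A₂ C₂ : ℝ} (hθ : 0 < θ) (ha : 0 < a) (hC₁ : 0 < C₁) (hC₂ : 0 < C₂) (hA₁ : 0 < A₁)
    (hA₂ : 0 < A₂)
    {S : ℕ → ℝ} {Wl Wu : ℕ → ℝ} (hS : ∀ J : ℕ, S J = ((J:ℝ) + 1) * (2:ℝ) ^ ((J:ℝ) * θ))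
    (hl : ∀ J n : ℕ, A₁ * n < S J → C₁ * (2:ℝ) ^ (-(J:ℝ) * a) ≤ Wl n)
    (hu : ∀ J n : ℕ, A₂ * S J ≤ n → Wu n ≤ C₂ * (2:ℝ) ^ (-(J:ℝ) * a)) :
    ∃ c₁ c₂ : ℝ, 0 < c₁ ∧ 0 < c₂ ∧ ∃ n₀ : ℕ, ∀ n : ℕ, n₀ ≤ n →
      c₁ * ((n:ℝ) ^ (-a / θ) * Real.log n ^ (a / θ)) ≤ Wl n ∧
      Wu n ≤ c₂ * ((n:ℝ) ^ (-a / θ) * Real.log n ^ (a / θ)) := by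
  have hl2 : 0 < Real.log 2 := Real.log_pos (by norm_num)
  set E₁ := max 1 (2 * θ * Real.log 2 * A₁) with hE₁
  set E₂ := max 1 (A₂ * (1 / (θ * Real.log 2) + 1)) with hE₂
  have hE1 : 1 ≤ E₁ := le_max_left _ _
  have hE2 : 1 ≤ E₂ := le_max_left _ _
  have hE1' : 2 * θ * Real.log 2 * A₁ ≤ E₁ := le_max_right _ _
  have hE2' : A₂ * (1 / (θ * Real.log 2) + 1) ≤ E₂ := le_max_right _ _
  have hev : ∀ᶠ n : ℕ in Filter.atTop, 1 ≤ Real.log n ∧ Real.log n ≤ (1 / E₂) * n := by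
    apply tendsto_natCast_atTop_atTop.eventually (p := fun x : ℝ => 1 ≤ Real.log x ∧ Real.log x ≤ (1 / E₂) * x)
    refine (Real.tendsto_log_atTop.eventually_ge_atTop 1).and ?_
    have := Real.isLittleO_log_id_atTop.bound (c := 1 / E₂) (by positivity)
    filter_upwards [this, Filter.eventually_ge_atTop 0] with x hx hx0
    rw [id, Real.norm_of_nonneg hx0] at hx
    exact (le_abs_self _).trans hx
  obtain ⟨n₀, hn₀⟩ := Filter.eventually_atTop.1 hev
  have hsplit : ∀ E : ℝ, 0 < E → ∀ n : ℕ, 1 ≤ Real.log n → (E * (n / Real.log n)) ^ (-a / θ) =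
      E ^ (-a / θ) * ((n:ℝ) ^ (-a / θ) * Real.log n ^ (a / θ)) := by
    intro E hE n hn
    have : 0 ≤ Real.log n := by linarith
    rw [Real.mul_rpow hE.le (by positivity), Real.div_rpow (Nat.cast_nonneg _) this]
    have h9 : Real.log n ^ (a / θ) = (Real.log n ^ (-a / θ))⁻¹ := by
      rw [← Real.rpow_neg this]; congr 1; ring
    rw [h9, ← div_eq_mul_inv]
  refine ⟨C₁ * (2:ℝ) ^ (-a) * E₁ ^ (-a / θ), C₂ * (2:ℝ) ^ a * (1 / E₂) ^ (-a / θ), by positivity,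
    by positivity, max n₀ 1, fun n hn => ?_⟩
  obtain ⟨hlog, hlog2⟩ := hn₀ n ((le_max_left _ _).trans hn)
  have hn1 : (0:ℝ) < n := by exact_mod_cast (le_max_right _ _).trans hn
  have hlog0 : 0 < Real.log n := by linarith
  have hlogn : Real.log n ≤ n := by
    refine hlog2.trans ?_
    rw [one_div, inv_mul_eq_div]
    exact div_le_self hn1.le hE2
  constructor
  · have hy1 : 1 ≤ E₁ * (n / Real.log n) := by
      have : 1 ≤ n / Real.log n := by rw [le_div_iff₀ hlog0]; linarith
      nlinarith
    have := lower_abs hθ ha hC₁ hl (n := n) (y := E₁ * (n / Real.log n)) hy1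
      (fun J _ h2 => by
        rw [hS]
        have hlt : Real.log n / 2 < ((J:ℝ) + 1) * θ * Real.log 2 := by
          have h3 := Real.log_lt_log (by linarith) h2
          rw [Real.log_rpow (by norm_num), Real.log_mul (by positivity) (by positivity),
            Real.log_div (by positivity) (by positivity)] at h3
          have h4 : 0 ≤ Real.log E₁ := Real.log_nonneg hE1
          have h5 : Real.log (Real.log n) ≤ Real.log n / 2 := by
            have h6 := Real.log_le_sub_one_of_pos (x := Real.log n / 2) (by positivity)
            rw [Real.log_div (by positivity) (by norm_num)] at h6
            have h7 := Real.log_le_sub_one_of_pos (x := (2:ℝ)) (by norm_num)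
            linarith
          linarith
        push_cast
        have h8 : A₁ * Real.log n ≤ ((J:ℝ) + 1) * E₁ := by
          have hJ : (0:ℝ) ≤ (J:ℝ) + 1 := by positivity
          have h9 := mul_le_mul_of_nonneg_left hE1' hJ
          nlinarith
        calc A₁ * n = (A₁ * Real.log n) * (n / Real.log n) := by field_simp
          _ ≤ (((J:ℝ) + 1) * E₁) * (n / Real.log n) := by gcongr
          _ = ((J:ℝ) + 1) * (E₁ * (n / Real.log n)) := by ring
          _ < ((J:ℝ) + 1) * (2:ℝ) ^ (((J:ℝ) + 1) * θ) := by gcongr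
          _ ≤ ((J:ℝ) + 1 + 1) * (2:ℝ) ^ (((J:ℝ) + 1) * θ) := by gcongr; linarith)
    rw [hsplit E₁ (by linarith) n hlog] at this
    rw [mul_assoc]
    exact this
  · have hE0 : 0 < E₂ := by linarith
    have hy1 : 1 ≤ 1 / E₂ * (n / Real.log n) := by
      rw [← mul_div_assoc, le_div_iff₀ hlog0]; linarith
    have := upper_abs hθ ha hC₂ hu (n := n) (y := 1 / E₂ * (n / Real.log n)) hy1
      (fun J h1 => by
        rw [hS]
        have hle : (J:ℝ) * (θ * Real.log 2) ≤ Real.log n := by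
          have h3 := Real.log_le_log (by positivity) h1
          rw [Real.log_rpow (by norm_num)] at h3
          have h4 : 1 / E₂ * (n / Real.log n) ≤ n := by
            have h5 : n / Real.log n ≤ n := div_le_self hn1.le hlog
            have h6 : 1 / E₂ ≤ 1 := by rw [div_le_one hE0]; exact hE2
            calc 1 / E₂ * (n / Real.log n) ≤ 1 * n := by gcongr
              _ = n := one_mul _
          have h7 := Real.log_le_log (by linarith) h4
          linarith
        have hJ : (J:ℝ) + 1 ≤ (1 / (θ * Real.log 2) + 1) * Real.log n := by
          have : (J:ℝ) ≤ Real.log n / (θ * Real.log 2) := by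
            rw [le_div_iff₀ (by positivity)]; exact hle
          rw [add_mul, one_div_mul_eq_div]; linarith
        calc A₂ * (((J:ℝ) + 1) * (2:ℝ) ^ ((J:ℝ) * θ))
            ≤ A₂ * (((1 / (θ * Real.log 2) + 1) * Real.log n) * (1 / E₂ * (n / Real.log n))) := by gcongr
          _ = (A₂ * (1 / (θ * Real.log 2) + 1)) * (n / E₂) := by
              generalize 1 / (θ * Real.log 2) + 1 = Z
              field_simp
          _ ≤ E₂ * (n / E₂) := by gcongr
          _ = n := by field_simp)
    rw [hsplit (1 / E₂) (by positivity) n hlog] at this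
    rw [mul_assoc]
    exact this

lemma SJ_comm (p q : ℝ) (J : ℕ) : SJ p q J = SJ q p J := by
  unfold SJ
  rw [← Finset.sum_range_reflect]
  refine Finset.sum_congr rfl fun j hj => ?_
  have hj' : j ≤ J := by simpa [Nat.lt_succ_iff] using hj
  rw [show J + 1 - 1 - j = J - j by omega, Nat.cast_sub hj']
  congr 1; ring

lemma SJ_ge (p q : ℝ) (J : ℕ) : (2:ℝ) ^ ((J:ℝ) * p) ≤ SJ p q J := by
  unfold SJ
  have := Finset.single_le_sum (f := fun j : ℕ => (2:ℝ) ^ ((j:ℝ) * p + ((J:ℝ) - j) * q)) (s := Finset.range (J + 1))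
    (fun i _ => by positivity) (Finset.mem_range.2 (Nat.lt_succ_self J))
  refine le_trans (le_of_eq ?_) this
  congr 1; ring

lemma SJ_le {p q : ℝ} (hpq : q < p) (J : ℕ) :
    SJ p q J ≤ (1 - (2:ℝ) ^ (-(p - q)))⁻¹ * (2:ℝ) ^ ((J:ℝ) * p) := by
  rw [SJ_comm]
  unfold SJ
  set x : ℝ := (2:ℝ) ^ (-(p - q)) with hx
  have hx0 : 0 ≤ x := by positivity
  have hx1 : x < 1 := Real.rpow_lt_one_of_one_lt_of_neg (by norm_num) (by linarith)
  have h1 : ∀ j ∈ Finset.range (J + 1), (2:ℝ) ^ ((j:ℝ) * q + ((J:ℝ) - j) * p) = x ^ j * (2:ℝ) ^ ((J:ℝ) * p) := by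
    intro j _
    rw [hx, ← Real.rpow_natCast, ← Real.rpow_mul (by norm_num), ← Real.rpow_add (by norm_num)]
    congr 1; ring
  rw [Finset.sum_congr rfl h1, ← Finset.sum_mul]
  gcongr
  have hs := hasSum_geometric_of_lt_one hx0 hx1
  exact sum_le_hasSum _ (fun i _ => by positivity) hs

lemma SJ_eq (p : ℝ) (J : ℕ) : SJ p p J = ((J:ℝ) + 1) * (2:ℝ) ^ ((J:ℝ) * p) := by
  unfold SJ
  rw [Finset.sum_congr rfl (g := fun _ => (2:ℝ) ^ ((J:ℝ) * p)) (fun j _ => by congr 1; ring)]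
  simp

end WQ

theorem widths_QStar_multi
    (T M : ℝ) (hT : 0 < T) (hM : 0 < M) (l : ℕ) (hl : 2 ≤ l)
    (r s : ℕ) (γ ζ : ℝ) (hr : 1 ≤ r) (hγ : 0 < γ)
    (hsζ : ((∃ n : ℤ, γ = n) ∧ (s : ℝ) = r + γ ∧ ζ = 0) ∨
           ((¬ ∃ n : ℤ, γ = n) ∧ (s : ℝ) = r + ⌊γ⌋ + 1 ∧ ζ = 1 - Int.fract γ))
    (v : ℝ) (hv : v = s / (s - γ))
    (X : Set C(Fin l → Set.Icc (0:ℝ) T, ℝ))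
    (hX : X = { g : C(Fin l → Set.Icc (0:ℝ) T, ℝ) |
      ∃ f : (Fin l → ℝ) → ℝ, MemQStarMulti l T M r s ζ f ∧
        ∀ t : Fin l → Set.Icc (0:ℝ) T, g t = f fun i => (t i : ℝ) }) :
    ∃ c₁ c₂ : ℝ, 0 < c₁ ∧ 0 < c₂ ∧ ∃ n₀ : ℕ, ∀ n : ℕ, n₀ ≤ n →
      (v > l / (l - 1 : ℝ) →
        (c₁ * (n : ℝ) ^ (-((s : ℝ) - γ) / (l - 1 : ℝ)) ≤ kolmogorovWidth n X ∧
          kolmogorovWidth n X ≤ c₂ * (n : ℝ) ^ (-((s : ℝ) - γ) / (l - 1 : ℝ))) ∧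
        (c₁ * (n : ℝ) ^ (-((s : ℝ) - γ) / (l - 1 : ℝ)) ≤ babenkoWidth n X ∧
          babenkoWidth n X ≤ c₂ * (n : ℝ) ^ (-((s : ℝ) - γ) / (l - 1 : ℝ)))) ∧
      (v = l / (l - 1 : ℝ) →
        (c₁ * ((n : ℝ) ^ (-(s : ℝ) / l) * Real.log n ^ ((s : ℝ) / l)) ≤ kolmogorovWidth n X ∧
          kolmogorovWidth n X ≤ c₂ * ((n : ℝ) ^ (-(s : ℝ) / l) * Real.log n ^ ((s : ℝ) / l))) ∧
        (c₁ * ((n : ℝ) ^ (-(s : ℝ) / l) * Real.log n ^ ((s : ℝ) / l)) ≤ babenkoWidth n X ∧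
          babenkoWidth n X ≤ c₂ * ((n : ℝ) ^ (-(s : ℝ) / l) * Real.log n ^ ((s : ℝ) / l)))) ∧
      (v < l / (l - 1 : ℝ) →
        (c₁ * (n : ℝ) ^ (-(s : ℝ) / l) ≤ kolmogorovWidth n X ∧
          kolmogorovWidth n X ≤ c₂ * (n : ℝ) ^ (-(s : ℝ) / l)) ∧
        (c₁ * (n : ℝ) ^ (-(s : ℝ) / l) ≤ babenkoWidth n X ∧
          babenkoWidth n X ≤ c₂ * (n : ℝ) ^ (-(s : ℝ) / l))) := by
  have hbasic : (s:ℝ) - r - ζ = γ ∧ 0 ≤ ζ ∧ ζ < 1 := by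
    rcases hsζ with ⟨_, h2, h3⟩ | ⟨h1, h2, h3⟩
    · subst h3; exact ⟨by linarith, le_rfl, zero_lt_one⟩
    · have hf : 0 < Int.fract γ := by
        refine lt_of_le_of_ne (Int.fract_nonneg γ) fun h => h1 ⟨⌊γ⌋, ?_⟩
        have := Int.floor_add_fract γ
        rw [← h] at this; linarith
      have hf1 := Int.fract_lt_one γ
      have := Int.floor_add_fract γ
      exact ⟨by linarith, by linarith, by linarith⟩
  obtain ⟨hg, hζ0, hζ1⟩ := hbasic
  have hrs' : (r:ℝ) < s := by linarith
  have hrs : r < s := by exact_mod_cast hrs'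
  have hr' : (1:ℝ) ≤ r := by exact_mod_cast hr
  obtain ⟨a, ha⟩ : ∃ a, (s:ℝ) - γ = a := ⟨_, rfl⟩
  have ha1 : 1 ≤ a := by linarith
  have ha0 : 0 < a := by linarith
  have hs0 : (0:ℝ) < s := by linarith
  have hl' : (2:ℝ) ≤ l := by exact_mod_cast hl
  have hl0 : (0:ℝ) < l := by linarith
  have hl1 : (0:ℝ) < (l:ℝ) - 1 := by linarith
  obtain ⟨A₁, C₁, hA₁, hC₁, hlow⟩ := WQ.lower_main hl hT hM hrs hζ1 hζ0 ha1 hγ ha hg X hX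
  obtain ⟨A₂, C₂, hA₂, hC₂, hupp⟩ := WQ.upper_main hl hT hM hrs hr ha1 hγ ha hg X hX
  have hlow' : ∀ J n : ℕ, A₁ * n < WQ.SJ (l - 1) (a / s * l) J →
      C₁ * (2:ℝ) ^ (-(J:ℝ) * a) ≤ min (kolmogorovWidth n X) (babenkoWidth n X) :=
    fun J n h => le_min (hlow J n h).1 (hlow J n h).2
  have hupp' : ∀ J n : ℕ, A₂ * WQ.SJ (l - 1) (a / s * l) J ≤ n →
      max (kolmogorovWidth n X) (babenkoWidth n X) ≤ C₂ * (2:ℝ) ^ (-(J:ℝ) * a) :=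
    fun J n h => max_le (hupp J n h).1 (hupp J n h).2
  rw [ha] at hv ⊢
  set p : ℝ := (l:ℝ) - 1 with hp
  set q : ℝ := a / s * l with hq
  have hq0 : 0 < q := by positivity
  have hsl : a / q = s / l := by rw [hq]; field_simp
  have hsl' : -(s:ℝ) / l = -a / q := by rw [neg_div, neg_div, hsl]
  have hvq : v = l / q := by rw [hv, hq]; field_simp
  rcases lt_trichotomy v (l / p) with h | h | h
  · have hpq : p < q := by
      rw [hvq] at h
      exact (div_lt_div_iff_of_pos_left hl0 hq0 hl1).1 h
    obtain ⟨c₁, c₂, h1, h2, n₀, h3⟩ := WQ.asym_pow (D := (1 - (2:ℝ) ^ (-(q - p)))⁻¹) hq0 ha0 hC₁ hC₂ hA₁ hA₂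
      (inv_pos.2 (by linarith [Real.rpow_lt_one_of_one_lt_of_neg (x := (2:ℝ)) (z := -(q - p)) (by norm_num) (by linarith)]))
      (S := fun J => WQ.SJ p q J) (fun J => by rw [WQ.SJ_comm]; exact WQ.SJ_ge q p J)
      (fun J => by rw [WQ.SJ_comm]; exact WQ.SJ_le hpq J) hlow' hupp'
    refine ⟨c₁, c₂, h1, h2, n₀, fun n hn => ⟨fun h' => absurd h' (not_lt.2 h.le), fun h' => absurd h' h.ne, fun _ => ?_⟩⟩
    obtain ⟨h4, h5⟩ := h3 n hn
    rw [hsl']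
    exact ⟨⟨h4.trans (min_le_left _ _), (le_max_left _ _).trans h5⟩,
      ⟨h4.trans (min_le_right _ _), (le_max_right _ _).trans h5⟩⟩
  · have hpq : q = p := by
      rw [hvq, div_eq_div_iff hq0.ne' hl1.ne'] at h
      exact (mul_left_cancel₀ hl0.ne' h).symm
    obtain ⟨c₁, c₂, h1, h2, n₀, h3⟩ := WQ.asym_log hq0 ha0 hC₁ hC₂ hA₁ hA₂
      (S := fun J => WQ.SJ p q J) (fun J => by rw [← hpq]; exact WQ.SJ_eq q J) hlow' hupp'
    refine ⟨c₁, c₂, h1, h2, n₀, fun n hn => ⟨fun h' => absurd h h'.ne', fun _ => ?_, fun h' => absurd h h'.ne⟩⟩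
    obtain ⟨h4, h5⟩ := h3 n hn
    rw [hsl', ← hsl]
    exact ⟨⟨h4.trans (min_le_left _ _), (le_max_left _ _).trans h5⟩,
      ⟨h4.trans (min_le_right _ _), (le_max_right _ _).trans h5⟩⟩
  · have hpq : q < p := by
      rw [hvq] at h
      exact (div_lt_div_iff_of_pos_left hl0 hl1 hq0).1 h
    obtain ⟨c₁, c₂, h1, h2, n₀, h3⟩ := WQ.asym_pow (D := (1 - (2:ℝ) ^ (-(p - q)))⁻¹) hl1 ha0 hC₁ hC₂ hA₁ hA₂
      (inv_pos.2 (by linarith [Real.rpow_lt_one_of_one_lt_of_neg (x := (2:ℝ)) (z := -(p - q)) (by norm_num) (by linarith)]))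
      (S := fun J => WQ.SJ p q J) (fun J => WQ.SJ_ge p q J)
      (fun J => WQ.SJ_le hpq J) hlow' hupp'
    refine ⟨c₁, c₂, h1, h2, n₀, fun n hn => ⟨fun _ => ?_, fun h' => absurd h' h.ne', fun h' => absurd h' (not_lt.2 h.le)⟩⟩
    obtain ⟨h4, h5⟩ := h3 n hn
    exact ⟨⟨h4.trans (min_le_left _ _), (le_max_left _ _).trans h5⟩,
      ⟨h4.trans (min_le_right _ _), (le_max_right _ _).trans h5⟩⟩
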